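/- arXiv:1803.11193 — 2 statements merged into one kernel-verified Lean document; each statement's English description precedes it below -/
import Mathlib

section
/- (3D Carleman estimate with zero Cauchy data on the outer sphere) Let Ω_μ = {x ∈ ℝ³ : μ < |x| < ρ}, r = |x|, and let w ∈ H²(Ω_μ) satisfy w = 0 and w_r = 0 on the outer sphere S_ρ = {|x| = ρ}. Then there exist λ₀ ≥ 1 and C > 0 depending only on Ω_μ such that for all λ ≥ λ₀: ∫_{Ω_μ}(Δw)² e^{2λr} dx ≥ (1/2)∫_{Ω_μ}(Δw)² e^{2λr} dx + Cλ∫_{Ω_μ}|∇w|² e^{2λr} dx + Cλ³∫_{Ω_μ} w² e^{2λr} dx − Cλ³ e^{2λμ}‖w‖²_{H²(Ω_μ)}. -/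
open MeasureTheory Real

noncomputable section

/-- The Laplacian `Δf = ∑ᵢ ∂²f/∂xᵢ²` on `ℝ³`. -/
def lap (f : EuclideanSpace ℝ (Fin 3) → ℝ) (x : EuclideanSpace ℝ (Fin 3)) : ℝ :=
  ∑ i : Fin 3,
    fderiv ℝ (fun y => fderiv ℝ f y (EuclideanSpace.single i 1)) x (EuclideanSpace.single i 1)

/-- The radial derivative `w_r = ∂w/∂r = ∇w · x/|x|`. -/
def radialDeriv (f : EuclideanSpace ℝ (Fin 3) → ℝ) (x : EuclideanSpace ℝ (Fin 3)) : ℝ :=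
  fderiv ℝ f x (‖x‖⁻¹ • x)

/-- The spherical annulus `{μ < |x| < ρ}` in `ℝ³`. -/
def annulus (μ ρ : ℝ) : Set (EuclideanSpace ℝ (Fin 3)) := {x | μ < ‖x‖ ∧ ‖x‖ < ρ}

/-- The squared `H²(Ω_μ)` Sobolev norm. -/
def H2normSq (μ ρ : ℝ) (w : EuclideanSpace ℝ (Fin 3) → ℝ) : ℝ :=
  ∫ x in annulus μ ρ,
    ((w x) ^ 2 + ‖gradient w x‖ ^ 2 + ‖fderiv ℝ (gradient w) x‖ ^ 2)

/-- The pointwise quadratic inequality behind the Carleman estimate, in terms of the values of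
`w`, `w_r`, `|∇w|²` and `Δw` and of `k = 1 / r`. -/
lemma carleman_quadratic_le (l k w q N L : ℝ) (hk : 0 < k) (hl : 8 * k ≤ l) (hN : q ^ 2 ≤ N) :
    (-4 * l * q - (4 * l ^ 2 + 2 * l * k) * w) * L + 4 * l * k * q ^ 2
        - (4 * l ^ 2 + 2 * l * k) * N - (8 * l ^ 3 + 4 * l ^ 2 * k) * (w * q)
        - (8 * l ^ 3 * k + 2 * l ^ 2 * k ^ 2) * w ^ 2
        + 2 * l * ((-4 * l * q - (4 * l ^ 2 + 2 * l * k) * w) * q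
          + (2 * l * N - (4 * l ^ 3 + 2 * l ^ 2 * k + l * k ^ 2) * w ^ 2))
        + l * k / 4 * N + l ^ 3 * k / 2 * w ^ 2 ≤ L ^ 2 := by
  have hlp : 0 < l := by linarith
  have hlk : 0 < l * k := mul_pos hlp hk
  have h1 : 0 ≤ 7 / 4 * (l * k) * (N - q ^ 2) := mul_nonneg (by positivity) (by linarith)
  have h2 : 0 ≤ l * k / 4 * (q + 2 * (l * w)) ^ 2 := by positivity
  have h3 : 0 ≤ 5 / 2 * (l * k) * (q + l * w + 2 * (k * w)) ^ 2 := by positivity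
  have h4 : 0 ≤ l * (l - 8 * k) * (q + l * w + k * w) ^ 2 :=
    mul_nonneg (mul_nonneg hlp.le (by linarith)) (sq_nonneg _)
  have h5 : 0 ≤ l * k * (l + 8 * k) * (l - 8 * k) * w ^ 2 :=
    mul_nonneg (mul_nonneg (by positivity) (by linarith)) (sq_nonneg _)
  have h6 : 0 ≤ l ^ 2 * k * (l - 8 * k) * w ^ 2 :=
    mul_nonneg (mul_nonneg (by positivity) (by linarith)) (sq_nonneg _)
  have h7 : 0 ≤ l ^ 2 * (q + l * w + k * w) ^ 2 := by positivity
  have h8 : 0 ≤ l ^ 3 * k * w ^ 2 := by positivity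
  have h9 : 0 ≤ (L + 2 * l * (q + l * w + k * w) - l * k * w) ^ 2 := sq_nonneg _
  nlinarith [h1, h2, h3, h4, h5, h6, h7, h8, h9]

/-- The pointwise quadratic lower bound controlling the contribution of the inner sphere. -/
lemma le_innerFlux_quadratic (l k w q N L : ℝ) (hk : 0 < k) (hl : 8 * k ≤ l) (hl1 : 1 ≤ l)
    (hN : q ^ 2 ≤ N) :
    -(9 * l ^ 2 * (L ^ 2 + N)) ≤
      (-4 * l * q - (4 * l ^ 2 + 2 * l * k) * w) * L + 4 * l * k * q ^ 2
        - (4 * l ^ 2 + 2 * l * k) * N - (8 * l ^ 3 + 4 * l ^ 2 * k) * (w * q)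
        - (8 * l ^ 3 * k + 2 * l ^ 2 * k ^ 2) * w ^ 2
        - 2 * l * ((-4 * l * q - (4 * l ^ 2 + 2 * l * k) * w) * q
          + (2 * l * N - (4 * l ^ 3 + 2 * l ^ 2 * k + l * k ^ 2) * w ^ 2)) := by
  have hlp : 0 < l := by linarith
  have hN0 : 0 ≤ N := (sq_nonneg q).trans hN
  have h1 : 0 ≤ (4 * l * q - L) ^ 2 := sq_nonneg _
  have h2 : 0 ≤ (4 * l ^ 2 * w - L) ^ 2 := sq_nonneg _
  have h3 : 0 ≤ l * k * (l * w - L / l) ^ 2 := by positivity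
  have h3' : l * k * (l * w - L / l) ^ 2 =
      l ^ 3 * k * w ^ 2 - 2 * l * k * (w * L) + k / l * L ^ 2 := by
    field_simp
    ring
  have h4 : k / l * L ^ 2 ≤ 1 / 8 * L ^ 2 := by
    refine mul_le_mul_of_nonneg_right ?_ (sq_nonneg _)
    rw [div_le_div_iff₀ hlp (by norm_num)]; linarith
  have h5 : 0 ≤ l ^ 3 * (l - 8 * k) * w ^ 2 :=
    mul_nonneg (mul_nonneg (by positivity) (by linarith)) (sq_nonneg _)
  have h6 : 0 ≤ l * (l - 8 * k) * N := mul_nonneg (mul_nonneg hlp.le (by linarith)) hN0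
  have h7 : 0 ≤ l * k * q ^ 2 := by positivity
  have h8 : 0 ≤ (l ^ 2 - 1) * L ^ 2 := mul_nonneg (by nlinarith) (sq_nonneg _)
  have h9 : 0 ≤ l ^ 4 * w ^ 2 := by positivity
  have h10 : 0 ≤ l ^ 2 * N := by positivity
  nlinarith [h1, h2, h3, h4, h5, h6, h7, h8, h9, h10]

lemma isOpen_annulus (μ ρ : ℝ) : IsOpen (annulus μ ρ) :=
  (isOpen_lt continuous_const continuous_norm).inter (isOpen_lt continuous_norm continuous_const)

/-- Truncating a Lipschitz function to an annulus keeps it Lipschitz if it vanishes on the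
boundary spheres. -/
lemma lipschitzWith_indicator_annulus {μ ρ : ℝ} {K : NNReal} {f : EuclideanSpace ℝ (Fin 3) → ℝ}
    (hf : LipschitzWith K f) (h0 : ∀ x, ‖x‖ = μ ∨ ‖x‖ = ρ → f x = 0) :
    LipschitzWith K ((annulus μ ρ).indicator f) := by
  have key : ∀ x y, x ∈ annulus μ ρ → y ∉ annulus μ ρ → |f x| ≤ K * dist x y := by
    intro x y hx hy
    have hcont : ContinuousOn (fun t : ℝ => ‖AffineMap.lineMap x y t‖) (Set.Icc 0 1) := by
      fun_prop
    obtain ⟨t, ht, hz⟩ : ∃ t ∈ Set.Icc (0 : ℝ) 1,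
        ‖AffineMap.lineMap x y t‖ = μ ∨ ‖AffineMap.lineMap x y t‖ = ρ := by
      rcases le_or_gt ‖y‖ μ with h | h
      · obtain ⟨t, ht, h⟩ := intermediate_value_Icc' zero_le_one hcont
          (show μ ∈ _ by simpa using ⟨h, hx.1.le⟩)
        exact ⟨t, ht, Or.inl h⟩
      · have h' : ρ ≤ ‖y‖ := not_lt.1 fun h' => hy ⟨h, h'⟩
        obtain ⟨t, ht, h⟩ := intermediate_value_Icc zero_le_one hcont
          (show ρ ∈ _ by simpa using ⟨hx.2.le, h'⟩)
        exact ⟨t, ht, Or.inr h⟩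
    have h1 := hf.dist_le_mul x (AffineMap.lineMap x y t)
    rw [h0 _ hz, dist_left_lineMap, Real.dist_eq, sub_zero, Real.norm_of_nonneg ht.1] at h1
    calc |f x| ≤ K * (t * dist x y) := h1
      _ ≤ K * (1 * dist x y) := by gcongr; exact ht.2
      _ = _ := by rw [one_mul]
  refine LipschitzWith.of_dist_le_mul fun x y => ?_
  by_cases hx : x ∈ annulus μ ρ <;> by_cases hy : y ∈ annulus μ ρ
  · simpa [hx, hy] using hf.dist_le_mul x y
  · simpa [hx, hy] using key x y hx hy
  · simpa [hx, hy, dist_comm, Real.dist_eq] using key y x hy hx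
  · simpa [hx, hy] using by positivity

lemma isCompact_closedAnnulus (μ ρ : ℝ) :
    IsCompact {x : EuclideanSpace ℝ (Fin 3) | μ ≤ ‖x‖ ∧ ‖x‖ ≤ ρ} := by
  refine (isCompact_closedBall (0 : EuclideanSpace ℝ (Fin 3)) ρ).of_isClosed_subset
    ((isClosed_le continuous_const continuous_norm).inter
      (isClosed_le continuous_norm continuous_const)) fun x hx => ?_
  simpa using hx.2

/-- A function that is `C¹` away from the origin and vanishes on the boundary of an annulus has
directional derivatives of zero mean there. -/
lemma setIntegral_annulus_fderiv_eq_zero {μ ρ : ℝ} (hμ : 0 < μ)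
    {f : EuclideanSpace ℝ (Fin 3) → ℝ} (hf : ∀ x, x ≠ 0 → ContDiffAt ℝ 1 f x)
    (h0 : ∀ x, ‖x‖ = μ ∨ ‖x‖ = ρ → f x = 0) (v : EuclideanSpace ℝ (Fin 3)) :
    ∫ x in annulus μ ρ, fderiv ℝ f x v = 0 := by
  rcases le_or_gt ρ 0 with hρ | hρ
  · have : annulus μ ρ = ∅ := by
      ext x
      simpa [annulus] using fun _ => hρ.trans (norm_nonneg x)
    simp [this]
  let χ : ContDiffBump (0 : EuclideanSpace ℝ (Fin 3)) :=
    ⟨μ / 4, μ / 2, by positivity, by linarith⟩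
  let ψ : ContDiffBump (0 : EuclideanSpace ℝ (Fin 3)) := ⟨ρ, ρ + 1, hρ, by linarith⟩
  let g : EuclideanSpace ℝ (Fin 3) → ℝ := fun x => (1 - χ x) * f x * ψ x
  have hg : ContDiff ℝ 1 g := by
    rw [contDiff_iff_contDiffAt]
    intro x
    by_cases hx : x = 0
    · have : g =ᶠ[nhds x] fun _ => 0 := by
        subst hx
        filter_upwards [χ.eventuallyEq_one] with y hy
        simp [g, hy]
      exact contDiffAt_const.congr_of_eventuallyEq this
    · exact ((contDiffAt_const.sub χ.contDiffAt).mul (hf x hx)).mul ψ.contDiffAt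
  have hgc : HasCompactSupport g := ψ.hasCompactSupport.mul_left
  obtain ⟨K, hK⟩ := hg.lipschitzWith_of_hasCompactSupport hgc one_ne_zero
  have hg0 : ∀ x, ‖x‖ = μ ∨ ‖x‖ = ρ → g x = 0 := fun x hx => by simp [g, h0 x hx]
  have hgf : ∀ x ∈ annulus μ ρ, g x = f x := by
    intro x hx
    have h1 : χ x = 0 := χ.zero_of_le_dist (by
      rw [dist_zero_right]; change μ / 2 ≤ _; linarith [hx.1])
    have h2 : ψ x = 1 := ψ.one_of_mem_closedBall (by simpa using hx.2.le)
    simp [g, h1, h2]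
  have hL := lipschitzWith_indicator_annulus hK hg0
  have hLc : HasCompactSupport ((annulus μ ρ).indicator g) :=
    hgc.mono (by rw [Set.support_indicator]; exact Set.inter_subset_right)
  have hconst : ∀ (c : ℝ) (x u : EuclideanSpace ℝ (Fin 3)), lineDeriv ℝ (fun _ => c) x u = 0 :=
    fun c x u => ((hasFDerivAt_const c x).hasLineDerivAt u).lineDeriv
  have h1 := LipschitzWith.integral_lineDeriv_mul_eq (μ := volume) (LipschitzWith.const (1 : ℝ)) hL hLc (-v)
  simp only [hconst, zero_mul, integral_zero, neg_neg, mul_one] at h1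
  rw [h1, ← integral_indicator (isOpen_annulus μ ρ).measurableSet]
  refine integral_congr_ae ?_
  have hs : ∀ R : ℝ, ∀ᵐ x : EuclideanSpace ℝ (Fin 3), ‖x‖ ≠ R := by
    intro R
    have := Measure.addHaar_sphere (volume : Measure (EuclideanSpace ℝ (Fin 3))) 0 R
    rw [ae_iff]
    convert this using 2
    ext x
    simp
  filter_upwards [hs μ, hs ρ] with x hxμ hxρ
  by_cases hx : x ∈ annulus μ ρ
  · have he : (annulus μ ρ).indicator g =ᶠ[nhds x] f := by
      filter_upwards [(isOpen_annulus μ ρ).mem_nhds hx] with y hy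
      simp [hy, hgf y hy]
    have hx0 : x ≠ 0 := fun h => by
      have := hx.1
      simp [h] at this
      linarith
    rw [Set.indicator_of_mem hx, he.lineDeriv_eq,
      ((hf x hx0).differentiableAt one_ne_zero).lineDeriv_eq_fderiv]
  · have he : (annulus μ ρ).indicator g =ᶠ[nhds x] fun _ => 0 := by
      have : ‖x‖ < μ ∨ ρ < ‖x‖ := by
        by_contra! h
        exact hx ⟨lt_of_le_of_ne h.1 hxμ.symm, lt_of_le_of_ne h.2 hxρ⟩
      rcases this with h | h
      · filter_upwards [continuous_norm.continuousAt.eventually_lt continuousAt_const h] with y hy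
        exact Set.indicator_of_notMem (fun h' => lt_asymm hy h'.1) _
      · filter_upwards [continuousAt_const.eventually_lt continuous_norm.continuousAt h] with y hy
        exact Set.indicator_of_notMem (fun h' => lt_asymm hy h'.2) _
    rw [Set.indicator_of_notMem hx, he.lineDeriv_eq, hconst]

/-- The `i`-th partial derivative of `w`. -/
def partialDeriv (w : EuclideanSpace ℝ (Fin 3) → ℝ) (i : Fin 3) (x : EuclideanSpace ℝ (Fin 3)) : ℝ :=
  fderiv ℝ w x (EuclideanSpace.single i 1)

/-- The `i`-th component of the outer radial unit vector. -/
def unitRadial (i : Fin 3) (x : EuclideanSpace ℝ (Fin 3)) : ℝ := ‖x‖⁻¹ * x i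

/-- The `i`-th component of the vector field whose divergence carries the boundary terms of the
Carleman estimate; the weight is chosen to vanish on the sphere of radius `μ`. -/
def carlemanField (μ l : ℝ) (w : EuclideanSpace ℝ (Fin 3) → ℝ) (i : Fin 3)
    (x : EuclideanSpace ℝ (Fin 3)) : ℝ :=
  (Real.exp (2 * l * ‖x‖) - Real.exp (4 * l * μ - 2 * l * ‖x‖)) *
    ((-4 * l * (∑ j, partialDeriv w j x * unitRadial j x)
        - (4 * l ^ 2 + 2 * l * ‖x‖⁻¹) * w x) * partialDeriv w i x
      + (2 * l * (∑ j, partialDeriv w j x ^ 2)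
        - (4 * l ^ 3 + 2 * l ^ 2 * ‖x‖⁻¹ + l * ‖x‖⁻¹ ^ 2) * w x ^ 2) * unitRadial i x)

lemma contDiff_partialDeriv {w : EuclideanSpace ℝ (Fin 3) → ℝ} (hw : ContDiff ℝ 2 w) (i : Fin 3) :
    ContDiff ℝ 1 (partialDeriv w i) :=
  (hw.fderiv_right (m := 1) (by norm_num)).clm_apply contDiff_const

lemma contDiffAt_inv_norm {x : EuclideanSpace ℝ (Fin 3)} (hx : x ≠ 0) :
    ContDiffAt ℝ 1 (fun y : EuclideanSpace ℝ (Fin 3) => ‖y‖⁻¹) x :=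
  (contDiffAt_norm ℝ hx).inv (norm_ne_zero_iff.2 hx)

lemma contDiffAt_unitRadial {x : EuclideanSpace ℝ (Fin 3)} (hx : x ≠ 0) (i : Fin 3) :
    ContDiffAt ℝ 1 (unitRadial i) x :=
  (contDiffAt_inv_norm hx).mul (EuclideanSpace.proj (𝕜 := ℝ) i).contDiff.contDiffAt

lemma contDiffAt_carlemanField {w : EuclideanSpace ℝ (Fin 3) → ℝ} (hw : ContDiff ℝ 2 w)
    (μ l : ℝ) (i : Fin 3) {x : EuclideanSpace ℝ (Fin 3)} (hx : x ≠ 0) :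
    ContDiffAt ℝ 1 (carlemanField μ l w i) x := by
  have hr : ContDiffAt ℝ 1 (fun y : EuclideanSpace ℝ (Fin 3) => ‖y‖) x := contDiffAt_norm ℝ hx
  have hk := contDiffAt_inv_norm hx
  have hn := contDiffAt_unitRadial hx
  have hp := fun j => (contDiff_partialDeriv hw j).contDiffAt (x := x)
  have hw1 : ContDiffAt ℝ 1 w x := (hw.of_le (by norm_num)).contDiffAt
  unfold carlemanField
  have hq : ContDiffAt ℝ 1 (fun y => ∑ j, partialDeriv w j y * unitRadial j y) x :=
    ContDiffAt.sum fun j _ => (hp j).mul (hn j)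
  have hN : ContDiffAt ℝ 1 (fun y => ∑ j, partialDeriv w j y ^ 2) x :=
    ContDiffAt.sum fun j _ => (hp j).pow 2
  have hpi := hp i
  have hni := hn i
  fun_prop

lemma sum_unitRadial_sq {x : EuclideanSpace ℝ (Fin 3)} (hx : x ≠ 0) :
    ∑ i, unitRadial i x ^ 2 = 1 := by
  simp only [unitRadial, mul_pow, ← Finset.mul_sum]
  have h : ‖x‖ ^ 2 = ∑ i, x i ^ 2 := by
    simp [EuclideanSpace.norm_sq_eq]
  rw [← h]
  have := norm_ne_zero_iff.2 hx
  field_simp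

lemma hasDerivAt_norm_line {x : EuclideanSpace ℝ (Fin 3)} (hx : x ≠ 0) (i : Fin 3) :
    HasDerivAt (fun t : ℝ => ‖x + t • EuclideanSpace.single i (1 : ℝ)‖) (unitRadial i x) 0 := by
  have hl : HasDerivAt (fun t : ℝ => x + t • EuclideanSpace.single i (1 : ℝ))
      (EuclideanSpace.single i (1 : ℝ)) 0 := by
    simpa using ((hasDerivAt_id (0 : ℝ)).smul_const (EuclideanSpace.single i (1 : ℝ))).const_add x
  have h := hl.norm_sq.sqrt (by simpa using hx)
  have h2 := norm_ne_zero_iff.2 hx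
  simp only [Real.sqrt_sq (norm_nonneg _)] at h
  convert h using 1
  simp only [unitRadial, zero_smul, add_zero, EuclideanSpace.inner_single_right]
  simp
  field_simp

lemma hasDerivAt_unitRadial_line {x : EuclideanSpace ℝ (Fin 3)} (hx : x ≠ 0) (i j : Fin 3) :
    HasDerivAt (fun t : ℝ => unitRadial j (x + t • EuclideanSpace.single i (1 : ℝ)))
      (‖x‖⁻¹ * ((if j = i then 1 else 0) - unitRadial i x * unitRadial j x)) 0 := by
  have hr := (hasDerivAt_norm_line hx i).fun_inv (by simpa using hx)
  have hj : HasDerivAt (fun t : ℝ => (x + t • EuclideanSpace.single i (1 : ℝ)) j)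
      (if j = i then 1 else 0) 0 := by
    have := ((hasDerivAt_id (0 : ℝ)).mul_const (if j = i then (1 : ℝ) else 0)).const_add (x j)
    simpa [Pi.single_apply] using this
  have h2 := norm_ne_zero_iff.2 hx
  refine (hr.fun_mul hj).congr_deriv ?_
  simp only [unitRadial, zero_smul, add_zero]
  field_simp
  ring

lemma hasDerivAt_line {f : EuclideanSpace ℝ (Fin 3) → ℝ} {x : EuclideanSpace ℝ (Fin 3)}
    (hf : DifferentiableAt ℝ f x) (v : EuclideanSpace ℝ (Fin 3)) :
    HasDerivAt (fun t : ℝ => f (x + t • v)) (fderiv ℝ f x v) 0 :=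
  hf.hasFDerivAt.hasLineDerivAt v

lemma fderiv_carlemanField {w : EuclideanSpace ℝ (Fin 3) → ℝ} (hw : ContDiff ℝ 2 w)
    (μ l : ℝ) (i : Fin 3) {x : EuclideanSpace ℝ (Fin 3)} (hx : x ≠ 0) :
    fderiv ℝ (carlemanField μ l w i) x (EuclideanSpace.single i 1) =
      2 * l * unitRadial i x *
        (Real.exp (2 * l * ‖x‖) + Real.exp (4 * l * μ - 2 * l * ‖x‖)) *
        ((-4 * l * (∑ j, partialDeriv w j x * unitRadial j x)
            - (4 * l ^ 2 + 2 * l * ‖x‖⁻¹) * w x) * partialDeriv w i x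
          + (2 * l * (∑ j, partialDeriv w j x ^ 2)
            - (4 * l ^ 3 + 2 * l ^ 2 * ‖x‖⁻¹ + l * ‖x‖⁻¹ ^ 2) * w x ^ 2) * unitRadial i x) +
      (Real.exp (2 * l * ‖x‖) - Real.exp (4 * l * μ - 2 * l * ‖x‖)) *
        ((-4 * l * (∑ j,
              (fderiv ℝ (partialDeriv w j) x (EuclideanSpace.single i 1) * unitRadial j x
                + partialDeriv w j x *
                  (‖x‖⁻¹ * ((if j = i then 1 else 0) - unitRadial i x * unitRadial j x))))
            - (4 * l ^ 2 + 2 * l * ‖x‖⁻¹) * partialDeriv w i x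
            + 2 * l * ‖x‖⁻¹ ^ 2 * unitRadial i x * w x) * partialDeriv w i x
          + (-4 * l * (∑ j, partialDeriv w j x * unitRadial j x)
            - (4 * l ^ 2 + 2 * l * ‖x‖⁻¹) * w x) *
            fderiv ℝ (partialDeriv w i) x (EuclideanSpace.single i 1)
          + (4 * l * (∑ j, partialDeriv w j x *
                fderiv ℝ (partialDeriv w j) x (EuclideanSpace.single i 1))
            - (4 * l ^ 3 + 2 * l ^ 2 * ‖x‖⁻¹ + l * ‖x‖⁻¹ ^ 2) * (2 * w x * partialDeriv w i x)
            + (2 * l ^ 2 * ‖x‖⁻¹ ^ 2 + 2 * l * ‖x‖⁻¹ ^ 3) * unitRadial i x * w x ^ 2) *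
              unitRadial i x
          + (2 * l * (∑ j, partialDeriv w j x ^ 2)
            - (4 * l ^ 3 + 2 * l ^ 2 * ‖x‖⁻¹ + l * ‖x‖⁻¹ ^ 2) * w x ^ 2) *
              (‖x‖⁻¹ * (1 - unitRadial i x * unitRadial i x))) := by
  have hX := (contDiffAt_carlemanField hw μ l i hx).differentiableAt one_ne_zero
  rw [← (hX.hasFDerivAt.hasLineDerivAt (EuclideanSpace.single i 1)).lineDeriv]
  apply HasLineDerivAt.lineDeriv
  unfold HasLineDerivAt carlemanField
  have hr := hasDerivAt_norm_line hx i
  have hk : HasDerivAt (fun t : ℝ => ‖x + t • EuclideanSpace.single i (1 : ℝ)‖⁻¹)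
      (-‖x‖⁻¹ ^ 2 * unitRadial i x) 0 := by
    refine (hr.fun_inv (by simpa using hx)).congr_deriv ?_
    simp only [zero_smul, add_zero]
    field_simp
  have hn := hasDerivAt_unitRadial_line hx i
  have hp := fun j => hasDerivAt_line
    (((contDiff_partialDeriv hw j).differentiable one_ne_zero) x) (EuclideanSpace.single i 1)
  have hw1 : HasDerivAt (fun t : ℝ => w (x + t • EuclideanSpace.single i (1 : ℝ)))
      (partialDeriv w i x) 0 :=
    hasDerivAt_line (hw.differentiable two_ne_zero x) (EuclideanSpace.single i 1)
  have hq := HasDerivAt.fun_sum (u := Finset.univ) fun j _ => (hp j).fun_mul (hn j)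
  have hN := HasDerivAt.fun_sum (u := Finset.univ) fun j _ => (hp j).fun_pow 2
  have hE1 := (hr.const_mul (2 * l)).exp
  have hE2 := ((hr.const_mul (2 * l)).const_sub (4 * l * μ)).exp
  have hni := hn i
  rw [if_pos rfl] at hni
  have ha := (hq.const_mul (-4 * l)).fun_sub (((hk.const_mul (2 * l)).const_add (4 * l ^ 2)).fun_mul hw1)
  have hb := (hN.const_mul (2 * l)).fun_sub ((((hk.const_mul (2 * l ^ 2)).const_add (4 * l ^ 3)).fun_add
    ((hk.fun_pow 2).const_mul l)).fun_mul (hw1.fun_pow 2))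
  have hF := (hE1.fun_sub hE2).fun_mul ((ha.fun_mul (hp i)).fun_add (hb.fun_mul hni))
  refine hF.congr_deriv ?_
  simp only [zero_smul, add_zero]
  simp only [Fin.sum_univ_three]
  ring

lemma div_carlemanField {w : EuclideanSpace ℝ (Fin 3) → ℝ} (hw : ContDiff ℝ 2 w)
    (μ l : ℝ) {x : EuclideanSpace ℝ (Fin 3)} (hx : x ≠ 0) (k q N : ℝ) (hk : k = ‖x‖⁻¹)
    (hq : q = ∑ j, partialDeriv w j x * unitRadial j x) (hN : N = ∑ j, partialDeriv w j x ^ 2) :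
    ∑ i, fderiv ℝ (carlemanField μ l w i) x (EuclideanSpace.single i 1) =
      (Real.exp (2 * l * ‖x‖) - Real.exp (4 * l * μ - 2 * l * ‖x‖)) *
        ((-4 * l * q - (4 * l ^ 2 + 2 * l * k) * w x) * lap w x + 4 * l * k * q ^ 2
          - (4 * l ^ 2 + 2 * l * k) * N - (8 * l ^ 3 + 4 * l ^ 2 * k) * (w x * q)
          - (8 * l ^ 3 * k + 2 * l ^ 2 * k ^ 2) * w x ^ 2) +
      (Real.exp (2 * l * ‖x‖) + Real.exp (4 * l * μ - 2 * l * ‖x‖)) *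
        (2 * l * ((-4 * l * q - (4 * l ^ 2 + 2 * l * k) * w x) * q
          + (2 * l * N - (4 * l ^ 3 + 2 * l ^ 2 * k + l * k ^ 2) * w x ^ 2))) := by
  have hsym : ∀ i j, fderiv ℝ (partialDeriv w j) x (EuclideanSpace.single i 1) =
      fderiv ℝ (partialDeriv w i) x (EuclideanSpace.single j 1) := by
    have hd : DifferentiableAt ℝ (fderiv ℝ w) x :=
      (hw.fderiv_right (m := 1) (by norm_num)).differentiable one_ne_zero x
    have h : ∀ i j, fderiv ℝ (partialDeriv w j) x (EuclideanSpace.single i 1) =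
        fderiv ℝ (fderiv ℝ w) x (EuclideanSpace.single i 1) (EuclideanSpace.single j 1) := by
      intro i j
      unfold partialDeriv
      rw [fderiv_clm_apply hd (differentiableAt_const _)]
      simp
    intro i j
    rw [h, h]
    exact hw.contDiffAt.isSymmSndFDerivAt (by simp) _ _
  have hlap : lap w x = ∑ i, fderiv ℝ (partialDeriv w i) x (EuclideanSpace.single i 1) := rfl
  have hu := sum_unitRadial_sq hx
  simp only [fderiv_carlemanField hw μ l _ hx, ← hq, ← hN, ← hk, hlap]
  have h01 := hsym 0 1
  have h02 := hsym 0 2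
  have h12 := hsym 1 2
  simp only [Fin.sum_univ_three] at hu hq hN ⊢
  simp only [h01, h02, h12]
  generalize Real.exp (2 * l * ‖x‖) = e1
  generalize Real.exp (4 * l * μ - 2 * l * ‖x‖) = e2
  simp only [↓reduceIte, Fin.isValue, show (0 : Fin 3) ≠ 1 by decide, show (0 : Fin 3) ≠ 2 by decide,
    show (1 : Fin 3) ≠ 0 by decide, show (1 : Fin 3) ≠ 2 by decide, show (2 : Fin 3) ≠ 0 by decide,
    show (2 : Fin 3) ≠ 1 by decide]
  generalize fderiv ℝ (partialDeriv w 0) x (EuclideanSpace.single 0 1) = H00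
  generalize fderiv ℝ (partialDeriv w 1) x (EuclideanSpace.single 1 1) = H11
  generalize fderiv ℝ (partialDeriv w 2) x (EuclideanSpace.single 2 1) = H22
  generalize fderiv ℝ (partialDeriv w 0) x (EuclideanSpace.single 1 1) = H01
  generalize fderiv ℝ (partialDeriv w 0) x (EuclideanSpace.single 2 1) = H02
  generalize fderiv ℝ (partialDeriv w 1) x (EuclideanSpace.single 2 1) = H12
  generalize partialDeriv w 0 x = p0 at *
  generalize partialDeriv w 1 x = p1 at *
  generalize partialDeriv w 2 x = p2 at *
  generalize unitRadial 0 x = n0 at *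
  generalize unitRadial 1 x = n1 at *
  generalize unitRadial 2 x = n2 at *
  generalize w x = u at *
  clear hk
  subst hq hN
  linear_combination (2 * l * (e1 + e2) * (2 * l * (p0 ^ 2 + p1 ^ 2 + p2 ^ 2) -
      (4 * l ^ 3 + 2 * l ^ 2 * k + l * k ^ 2) * u ^ 2) +
    (e1 - e2) * ((2 * l ^ 2 * k ^ 2 + 2 * l * k ^ 3) * u ^ 2 -
      (2 * l * (p0 ^ 2 + p1 ^ 2 + p2 ^ 2) -
        (4 * l ^ 3 + 2 * l ^ 2 * k + l * k ^ 2) * u ^ 2) * k)) * hu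

lemma ne_zero_of_le_norm {μ : ℝ} (hμ : 0 < μ) {x : EuclideanSpace ℝ (Fin 3)} (hx : μ ≤ ‖x‖) :
    x ≠ 0 :=
  norm_pos_iff.1 (hμ.trans_le hx)

lemma integrableOn_annulus {μ ρ : ℝ} {f : EuclideanSpace ℝ (Fin 3) → ℝ}
    (hf : ContinuousOn f {x | μ ≤ ‖x‖ ∧ ‖x‖ ≤ ρ}) : IntegrableOn f (annulus μ ρ) :=
  (hf.integrableOn_compact (isCompact_closedAnnulus μ ρ)).mono_set fun _ hx => ⟨hx.1.le, hx.2.le⟩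

/-- Vanishing Cauchy data on a sphere force the full derivative to vanish there. -/
lemma fderiv_eq_zero_of_cauchyData {ρ : ℝ} (hρ : 0 < ρ) {w : EuclideanSpace ℝ (Fin 3) → ℝ}
    (hw : ContDiff ℝ 2 w)
    (h0 : ∀ x ∈ Metric.sphere (0 : EuclideanSpace ℝ (Fin 3)) ρ, w x = 0 ∧ radialDeriv w x = 0)
    {x : EuclideanSpace ℝ (Fin 3)} (hx : ‖x‖ = ρ) : fderiv ℝ w x = 0 := by
  have hext : IsLocalExtrOn w {y | ‖y‖ ^ 2 = ‖x‖ ^ 2} x := by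
    refine Or.inl ?_
    filter_upwards [self_mem_nhdsWithin] with y hy
    have hy' : ‖y‖ = ρ := by
      rw [← hx]
      exact (sq_eq_sq₀ (norm_nonneg _) (norm_nonneg _)).1 hy
    rw [(h0 x (by simpa using hx)).1, (h0 y (by simpa using hy')).1]
  have hstrict : HasStrictFDerivAt w (fderiv ℝ w x) x :=
    hw.contDiffAt.hasStrictFDerivAt two_ne_zero
  obtain ⟨a, b, hab, h⟩ := hext.exists_multipliers_of_hasStrictFDerivAt_1d
    (hasStrictFDerivAt_norm_sq x) hstrict
  have hr : fderiv ℝ w x x = 0 := by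
    have := (h0 x (by simpa using hx)).2
    simp only [radialDeriv, map_smul, smul_eq_mul, hx, mul_eq_zero, inv_eq_zero] at this
    exact this.resolve_left hρ.ne'
  have ha : a = 0 := by
    have := congrArg (fun f : EuclideanSpace ℝ (Fin 3) →L[ℝ] ℝ => f x) h
    simp [hr, hx] at this
    exact this.resolve_right hρ.ne'
  have hb : b ≠ 0 := fun hb => hab (by simp [ha, hb])
  simpa [ha, hb] using h

lemma carlemanField_eq_zero {μ ρ l : ℝ} (hρ : 0 < ρ) {w : EuclideanSpace ℝ (Fin 3) → ℝ}
    (hw : ContDiff ℝ 2 w)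
    (h0 : ∀ x ∈ Metric.sphere (0 : EuclideanSpace ℝ (Fin 3)) ρ, w x = 0 ∧ radialDeriv w x = 0)
    (i : Fin 3) {x : EuclideanSpace ℝ (Fin 3)} (hx : ‖x‖ = μ ∨ ‖x‖ = ρ) :
    carlemanField μ l w i x = 0 := by
  rcases hx with hx | hx
  · have : 2 * l * ‖x‖ = 4 * l * μ - 2 * l * ‖x‖ := by rw [hx]; ring
    simp only [carlemanField, ← this, sub_self, zero_mul]
  · have h1 := fderiv_eq_zero_of_cauchyData hρ hw h0 hx
    simp [carlemanField, partialDeriv, h1, (h0 x (by simpa using hx)).1]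

lemma continuousOn_fderiv_carlemanField {μ ρ : ℝ} (hμ : 0 < μ)
    {w : EuclideanSpace ℝ (Fin 3) → ℝ} (hw : ContDiff ℝ 2 w) (l : ℝ) (i : Fin 3) :
    ContinuousOn (fun x => fderiv ℝ (carlemanField μ l w i) x (EuclideanSpace.single i 1))
      {x | μ ≤ ‖x‖ ∧ ‖x‖ ≤ ρ} := fun x hx =>
  (((contDiffAt_carlemanField hw μ l i (ne_zero_of_le_norm hμ hx.1)).fderiv_right
    (m := 0) (by simp)).continuousAt.clm_apply continuousAt_const).continuousWithinAt

/-- The divergence theorem for the Carleman field: it has no flux through the boundary. -/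
lemma setIntegral_div_carlemanField {μ ρ : ℝ} (hμ : 0 < μ) (hρ : 0 < ρ)
    {w : EuclideanSpace ℝ (Fin 3) → ℝ} (hw : ContDiff ℝ 2 w)
    (h0 : ∀ x ∈ Metric.sphere (0 : EuclideanSpace ℝ (Fin 3)) ρ, w x = 0 ∧ radialDeriv w x = 0)
    (l : ℝ) :
    ∫ x in annulus μ ρ, ∑ i, fderiv ℝ (carlemanField μ l w i) x (EuclideanSpace.single i 1)
      = 0 := by
  rw [integral_finsetSum _ fun i _ =>
    integrableOn_annulus (continuousOn_fderiv_carlemanField hμ hw l i)]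
  exact Finset.sum_eq_zero fun i _ => setIntegral_annulus_fderiv_eq_zero hμ
    (fun x hx => contDiffAt_carlemanField hw μ l i hx)
    (fun x hx => carlemanField_eq_zero hρ hw h0 i hx) _

lemma contDiff_gradient {w : EuclideanSpace ℝ (Fin 3) → ℝ} (hw : ContDiff ℝ 2 w) :
    ContDiff ℝ 1 (gradient w) :=
  (InnerProductSpace.toDual ℝ (EuclideanSpace ℝ (Fin 3))).symm.contDiff.comp
    (hw.fderiv_right (m := 1) (by norm_num))

lemma gradient_apply (w : EuclideanSpace ℝ (Fin 3) → ℝ) (x : EuclideanSpace ℝ (Fin 3))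
    (i : Fin 3) : gradient w x i = partialDeriv w i x := by
  have : inner ℝ (gradient w x) (EuclideanSpace.single i 1) = partialDeriv w i x := by
    simp [gradient, partialDeriv]
  rw [EuclideanSpace.inner_single_right] at this
  simpa using this

lemma norm_gradient_sq (w : EuclideanSpace ℝ (Fin 3) → ℝ) (x : EuclideanSpace ℝ (Fin 3)) :
    ‖gradient w x‖ ^ 2 = ∑ j, partialDeriv w j x ^ 2 := by
  simp [EuclideanSpace.norm_sq_eq, gradient_apply]

lemma lap_sq_le {w : EuclideanSpace ℝ (Fin 3) → ℝ} (hw : ContDiff ℝ 2 w)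
    (x : EuclideanSpace ℝ (Fin 3)) : lap w x ^ 2 ≤ 9 * ‖fderiv ℝ (gradient w) x‖ ^ 2 := by
  have hd : DifferentiableAt ℝ (gradient w) x := (contDiff_gradient hw).differentiable one_ne_zero x
  have h : ∀ i : Fin 3, |fderiv ℝ (partialDeriv w i) x (EuclideanSpace.single i 1)| ≤
      ‖fderiv ℝ (gradient w) x‖ := by
    intro i
    have h1 : partialDeriv w i = fun y => EuclideanSpace.proj (𝕜 := ℝ) i (gradient w y) := by
      ext y
      simp [gradient_apply]
    have h2 : HasFDerivAt (partialDeriv w i)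
        ((EuclideanSpace.proj (𝕜 := ℝ) i).comp (fderiv ℝ (gradient w) x)) x := by
      rw [h1]
      exact (EuclideanSpace.proj (𝕜 := ℝ) i).hasFDerivAt.comp x hd.hasFDerivAt
    rw [h2.fderiv]
    calc _ ≤ ‖fderiv ℝ (gradient w) x (EuclideanSpace.single i 1)‖ :=
          PiLp.norm_apply_le (fderiv ℝ (gradient w) x (EuclideanSpace.single i 1)) i
      _ ≤ ‖fderiv ℝ (gradient w) x‖ * ‖EuclideanSpace.single i (1 : ℝ)‖ :=
          ContinuousLinearMap.le_opNorm _ _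
      _ = _ := by simp
  have h3 : |lap w x| ≤ 3 * ‖fderiv ℝ (gradient w) x‖ := by
    calc |lap w x| ≤ ∑ i, |fderiv ℝ (partialDeriv w i) x (EuclideanSpace.single i 1)| :=
          Finset.abs_sum_le_sum_abs _ _
      _ ≤ ∑ _i : Fin 3, ‖fderiv ℝ (gradient w) x‖ := Finset.sum_le_sum fun i _ => h i
      _ = _ := by simp
  calc lap w x ^ 2 = |lap w x| ^ 2 := (sq_abs _).symm
    _ ≤ (3 * ‖fderiv ℝ (gradient w) x‖) ^ 2 := by gcongr
    _ = _ := by ring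

lemma continuous_lap {w : EuclideanSpace ℝ (Fin 3) → ℝ} (hw : ContDiff ℝ 2 w) :
    Continuous (lap w) :=
  continuous_finsetSum _ fun i _ =>
    ((contDiff_partialDeriv hw i).continuous_fderiv one_ne_zero).clm_apply continuous_const

/-- The pointwise Carleman inequality, up to a divergence. -/
lemma carleman_pointwise {μ ρ l : ℝ} (hμ : 0 < μ) (hl1 : 1 ≤ l) (hl : 8 / μ ≤ l)
    {w : EuclideanSpace ℝ (Fin 3) → ℝ} (hw : ContDiff ℝ 2 w)
    {x : EuclideanSpace ℝ (Fin 3)} (hx : x ∈ annulus μ ρ) :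
    l / (4 * ρ) * (‖gradient w x‖ ^ 2 * Real.exp (2 * l * ‖x‖))
      + l ^ 3 / (2 * ρ) * (w x ^ 2 * Real.exp (2 * l * ‖x‖))
      - 81 * l ^ 2 * Real.exp (2 * l * μ) *
        (w x ^ 2 + ‖gradient w x‖ ^ 2 + ‖fderiv ℝ (gradient w) x‖ ^ 2)
      + ∑ i, fderiv ℝ (carlemanField μ l w i) x (EuclideanSpace.single i 1)
      ≤ lap w x ^ 2 * Real.exp (2 * l * ‖x‖) := by
  have hr : 0 < ‖x‖ := hμ.trans hx.1
  have hx0 : x ≠ 0 := norm_pos_iff.1 hr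
  have hk : 0 < ‖x‖⁻¹ := inv_pos.2 hr
  have hlp : 0 < l := by linarith
  have hkl : 8 * ‖x‖⁻¹ ≤ l := by
    refine le_trans ?_ hl
    rw [div_eq_mul_inv]
    gcongr
    exact hx.1.le
  have hρk : ρ⁻¹ ≤ ‖x‖⁻¹ := by
    gcongr
    exact hx.2.le
  set q := ∑ j, partialDeriv w j x * unitRadial j x with hq
  set N := ‖gradient w x‖ ^ 2 with hN
  have hN' : N = ∑ j, partialDeriv w j x ^ 2 := norm_gradient_sq w x
  have hqN : q ^ 2 ≤ N := by
    have := Finset.sum_mul_sq_le_sq_mul_sq Finset.univ (fun j => partialDeriv w j x)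
      (fun j => unitRadial j x)
    rwa [sum_unitRadial_sq hx0, mul_one, ← hN'] at this
  rw [div_carlemanField hw μ l hx0 _ q N rfl hq hN']
  have h1 := carleman_quadratic_le l ‖x‖⁻¹ (w x) q N (lap w x) hk hkl hqN
  have h2 := le_innerFlux_quadratic l ‖x‖⁻¹ (w x) q N (lap w x) hk hkl hl1 hqN
  have h3 := lap_sq_le hw x
  have he : Real.exp (4 * l * μ - 2 * l * ‖x‖) ≤ Real.exp (2 * l * μ) := by
    apply Real.exp_le_exp.2
    nlinarith [mul_le_mul_of_nonneg_left hx.1.le hlp.le]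
  have hE := Real.exp_pos (2 * l * ‖x‖)
  have hE' := Real.exp_pos (4 * l * μ - 2 * l * ‖x‖)
  have hg1 : l / (4 * ρ) * N ≤ l * ‖x‖⁻¹ / 4 * N := by
    rw [show l / (4 * ρ) = l * ρ⁻¹ / 4 by rw [div_mul_eq_div_div]; ring]
    gcongr
  have hg2 : l ^ 3 / (2 * ρ) * w x ^ 2 ≤ l ^ 3 * ‖x‖⁻¹ / 2 * w x ^ 2 := by
    rw [show l ^ 3 / (2 * ρ) = l ^ 3 * ρ⁻¹ / 2 by rw [div_mul_eq_div_div]; ring]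
    gcongr
  have hN0 : 0 ≤ N := by positivity
  have h4 : Real.exp (4 * l * μ - 2 * l * ‖x‖) * (9 * l ^ 2 * (lap w x ^ 2 + N)) ≤
      Real.exp (2 * l * μ) *
        (9 * l ^ 2 * (9 * (w x ^ 2 + N + ‖fderiv ℝ (gradient w) x‖ ^ 2))) := by
    gcongr
    nlinarith [sq_nonneg (w x)]
  have h5 := mul_le_mul_of_nonneg_left h1 hE.le
  have h6 := mul_le_mul_of_nonneg_left h2 hE'.le
  have h7 := mul_le_mul_of_nonneg_left hg1 hE.le
  have h8 := mul_le_mul_of_nonneg_left hg2 hE.le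
  linarith

/-- 3D Carleman estimate with zero Cauchy data on the outer sphere.
Let `Ω_μ = {μ < |x| < ρ} ⊂ ℝ³`, `r = |x|`, and let `w` satisfy `w = 0` and `w_r = 0`
on the outer sphere `S_ρ`.  Then there exist `λ₀ ≥ 1` and `C > 0` depending only on
`Ω_μ` such that for all `λ ≥ λ₀` the Carleman estimate holds without boundary terms,
with only the penalty term `Cλ³e^{2λμ}‖w‖²_{H²(Ω_μ)}`. -/
theorem carleman_estimate_3D_zero_cauchy_data (μ ρ : ℝ) (hμ : 0 < μ) (hμρ : μ < ρ) :
    ∃ lam₀ : ℝ, 1 ≤ lam₀ ∧ ∃ C : ℝ, 0 < C ∧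
      ∀ w : EuclideanSpace ℝ (Fin 3) → ℝ, ContDiff ℝ 2 w →
      (∀ x ∈ Metric.sphere (0 : EuclideanSpace ℝ (Fin 3)) ρ, w x = 0 ∧ radialDeriv w x = 0) →
      ∀ lam : ℝ, lam₀ ≤ lam →
        (∫ x in annulus μ ρ, (lap w x) ^ 2 * Real.exp (2 * lam * ‖x‖)) ≥
          (1/2) * (∫ x in annulus μ ρ, (lap w x) ^ 2 * Real.exp (2 * lam * ‖x‖))
          + C * lam * (∫ x in annulus μ ρ, ‖gradient w x‖ ^ 2 * Real.exp (2 * lam * ‖x‖))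
          + C * lam ^ 3 * (∫ x in annulus μ ρ, (w x) ^ 2 * Real.exp (2 * lam * ‖x‖))
          - C * lam ^ 3 * Real.exp (2 * lam * μ) * H2normSq μ ρ w := by
  have hρ : 0 < ρ := hμ.trans hμρ
  refine ⟨1 + 8 / μ + 324 * ρ, ?_, 1 / (8 * ρ), by positivity, ?_⟩
  · have : 0 < 8 / μ := by positivity
    linarith
  intro w hw h0 l hl
  have h8 : 0 < 8 / μ := by positivity
  have hl1 : 1 ≤ l := by linarith
  have hlμ : 8 / μ ≤ l := by linarith
  have hlρ : 324 * ρ ≤ l := by linarith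
  have hgrad := (contDiff_gradient hw).continuous
  have hhess := (contDiff_gradient hw).continuous_fderiv one_ne_zero
  have hlap := continuous_lap hw
  have hwc := hw.continuous
  have i1 : IntegrableOn (fun x => ‖gradient w x‖ ^ 2 * Real.exp (2 * l * ‖x‖)) (annulus μ ρ) :=
    integrableOn_annulus (by fun_prop)
  have i2 : IntegrableOn (fun x => w x ^ 2 * Real.exp (2 * l * ‖x‖)) (annulus μ ρ) :=
    integrableOn_annulus (by fun_prop)
  have i3 : IntegrableOn (fun x => w x ^ 2 + ‖gradient w x‖ ^ 2 + ‖fderiv ℝ (gradient w) x‖ ^ 2)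
      (annulus μ ρ) := integrableOn_annulus (by fun_prop)
  have i4 : IntegrableOn (fun x => ∑ i,
      fderiv ℝ (carlemanField μ l w i) x (EuclideanSpace.single i 1)) (annulus μ ρ) :=
    integrableOn_annulus (continuousOn_finsetSum _ fun i _ =>
      continuousOn_fderiv_carlemanField hμ hw l i)
  have i5 : IntegrableOn (fun x => lap w x ^ 2 * Real.exp (2 * l * ‖x‖)) (annulus μ ρ) :=
    integrableOn_annulus (by fun_prop)
  have key := setIntegral_mono_on
    ((((i1.const_mul (l / (4 * ρ))).add (i2.const_mul (l ^ 3 / (2 * ρ)))).sub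
      (i3.const_mul (81 * l ^ 2 * Real.exp (2 * l * μ)))).add i4) i5
    (isOpen_annulus μ ρ).measurableSet
    fun x hx => carleman_pointwise hμ hl1 hlμ hw hx
  rw [integral_add' (((i1.const_mul (l / (4 * ρ))).add (i2.const_mul (l ^ 3 / (2 * ρ)))).sub
      (i3.const_mul (81 * l ^ 2 * Real.exp (2 * l * μ)))) i4,
    integral_sub' ((i1.const_mul (l / (4 * ρ))).add (i2.const_mul (l ^ 3 / (2 * ρ))))
      (i3.const_mul (81 * l ^ 2 * Real.exp (2 * l * μ))),
    integral_add' (i1.const_mul (l / (4 * ρ))) (i2.const_mul (l ^ 3 / (2 * ρ))),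
    integral_const_mul, integral_const_mul, integral_const_mul,
    setIntegral_div_carlemanField hμ hρ hw h0, add_zero] at key
  change _ - 81 * l ^ 2 * Real.exp (2 * l * μ) * H2normSq μ ρ w ≤ _ at key
  have hB : 0 ≤ ∫ x in annulus μ ρ, w x ^ 2 * Real.exp (2 * l * ‖x‖) :=
    integral_nonneg fun x => by positivity
  have hH : 0 ≤ H2normSq μ ρ w := integral_nonneg fun x => by positivity
  have hpen : 81 / 2 * l ^ 2 * Real.exp (2 * l * μ) * H2normSq μ ρ w ≤
      1 / (8 * ρ) * l ^ 3 * Real.exp (2 * l * μ) * H2normSq μ ρ w := by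
    refine mul_le_mul_of_nonneg_right (mul_le_mul_of_nonneg_right ?_ (Real.exp_pos _).le) hH
    rw [show 1 / (8 * ρ) * l ^ 3 = l / (8 * ρ) * l ^ 2 by ring]
    refine mul_le_mul_of_nonneg_right ?_ (sq_nonneg l)
    rw [le_div_iff₀ (by positivity)]
    linarith
  have e1 : l / (4 * ρ) = 2 * (1 / (8 * ρ) * l) := by field_simp; norm_num
  have e2 : l ^ 3 / (2 * ρ) = 4 * (1 / (8 * ρ) * l ^ 3) := by field_simp; norm_num
  rw [e1, e2] at key
  have hC : 0 ≤ 1 / (8 * ρ) * l ^ 3 * ∫ x in annulus μ ρ, w x ^ 2 * Real.exp (2 * l * ‖x‖) := by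
    positivity
  linarith
end
end

section
/- (2D Carleman estimate for the Laplacian with weight e^{2λr}) Let Ω_μ = {x ∈ ℝ² : μ < |x| < ρ} with 0 < μ < ρ, and r = |x|. There exist λ₀ = λ₀(Ω_μ) ≥ 1 and C = C(Ω_μ) > 0 such that for any w ∈ H²(Ω_μ) and all λ ≥ λ₀: ∫_{Ω_μ}(Δw)² e^{2λr} dx ≥ (1/2)∫_{Ω_μ}(Δw)² e^{2λr} dx + Cλ∫_{Ω_μ}|∇w|² e^{2λr} dx + Cλ³∫_{Ω_μ} w² e^{2λr} dx − Cλ e^{2λρ}∫_{S_ρ} w_r² dS − Cλ³ e^{2λρ}∫_{S_ρ} w² dS − Cλ e^{2λμ}‖w‖²_{H²(Ω_μ)}. -/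
open MeasureTheory Real

noncomputable section

/-- The Laplacian `Δf = ∑ᵢ ∂²f/∂xᵢ²` on `ℝ²`. -/
def lap2 (f : EuclideanSpace ℝ (Fin 2) → ℝ) (x : EuclideanSpace ℝ (Fin 2)) : ℝ :=
  ∑ i : Fin 2,
    fderiv ℝ (fun y => fderiv ℝ f y (EuclideanSpace.single i 1)) x (EuclideanSpace.single i 1)

/-- The radial derivative `w_r = ∂w/∂r = ∇w · x/|x|`. -/
def radialDeriv2 (f : EuclideanSpace ℝ (Fin 2) → ℝ) (x : EuclideanSpace ℝ (Fin 2)) : ℝ :=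
  fderiv ℝ f x (‖x‖⁻¹ • x)

/-- The annulus `{μ < |x| < ρ}` in `ℝ²`. -/
def annulus2 (μ ρ : ℝ) : Set (EuclideanSpace ℝ (Fin 2)) := {x | μ < ‖x‖ ∧ ‖x‖ < ρ}

/-- The squared `H²(Ω_μ)` Sobolev norm. -/
def H2normSq2 (μ ρ : ℝ) (w : EuclideanSpace ℝ (Fin 2) → ℝ) : ℝ :=
  ∫ x in annulus2 μ ρ,
    ((w x) ^ 2 + ‖gradient w x‖ ^ 2 + ‖fderiv ℝ (gradient w) x‖ ^ 2)

lemma bulk_lower_bound {μ ρ r s ε γ e f a b c B : ℝ} (hμ : 0 < μ) (hr : μ ≤ r) (hrρ : r ≤ ρ)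
    (hs : 8 ≤ s) (hε : 0 < ε) (hε1 : ε ≤ 1) (hγ : 0 < γ) (hγ8 : γ ≤ 1 / 8) (hγρ : γ * (2 * ρ) ≤ 1)
    (hsε : 8 ≤ s * ε) (hsγ : 8 ≤ s * γ) (hsμ : 1 ≤ s * μ) (he0 : 0 ≤ e) (he1 : e ≤ 1)
    (hB : B = (2 * s ^ 2 * (1 + ε - e) - s * e + γ * (2 * e - 1)) * b ^ 2
      + (s ^ 4 * (γ + e * (1 / 2 - 2 * γ)) + s ^ 3 * e * (1 / 4 - 2 * γ) - γ * s ^ 2 * e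
        - (1 + ε - e) / (4 * r ^ 3) - γ * (2 * e - 1) / (4 * r ^ 2)) * a ^ 2
      + ((1 + ε - e) / r ^ 3 + γ * (2 * e - 1) / r ^ 2) * c ^ 2) :
    γ / 2 * s ^ 6 * a ^ 2 + ε / 2 * s ^ 4 * b ^ 2 + γ * s ^ 2 * (c ^ 2 / r ^ 2)
      ≤ 2 / γ * f ^ 2
        + s ^ 2 * (B + f * ((1 + ε - e) * b + (-(s * e) / 2 + γ * (2 * e - 1)) * a)) := by
  have hs0 : 0 < s := by linarith
  have hr0 : 0 < r := by linarith
  set m := 1 + ε - e with hm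
  set n := -(s * e) / 2 + γ * (2 * e - 1) with hn
  have hm0 : ε ≤ m := by linarith
  have hm2 : m ≤ 2 := by linarith
  have hnabs : |n| ≤ s := by
    rw [abs_le]; constructor <;> linarith [mul_nonneg hs0.le he0, mul_le_mul_of_nonneg_left he1 hs0.le, mul_nonneg hγ.le he0, mul_le_mul_of_nonneg_left he1 hγ.le]
  have hn2 : n ^ 2 ≤ s ^ 2 := by
    rw [← sq_abs n]; exact pow_le_pow_left₀ (abs_nonneg _) hnabs 2
  -- radial part
  have hb : ε / 2 * s ^ 2 ≤ 2 * s ^ 2 * m - s * e + γ * (2 * e - 1) - s ^ 2 * m := by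
    have h1 : s ^ 2 * ε ≤ s ^ 2 * m := mul_le_mul_of_nonneg_left hm0 (by positivity)
    have h2 : s * 8 ≤ s * (s * ε) := mul_le_mul_of_nonneg_left hsε hs0.le
    have h3 : s * e ≤ s * 1 := mul_le_mul_of_nonneg_left he1 hs0.le
    linarith [mul_nonneg hγ.le he0]
  -- angular part
  have hc : γ / r ^ 2 ≤ m / r ^ 3 + γ * (2 * e - 1) / r ^ 2 := by
    have h1 : γ * 2 * (1 - e) * r ≤ m := by
      have h1 : γ * 2 * r ≤ 1 :=
        (mul_le_mul_of_nonneg_left hrρ (by positivity)).trans (by linarith)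
      have h2 := mul_le_mul_of_nonneg_left h1 (sub_nonneg.2 he1)
      linarith
    have : m / r ^ 3 + γ * (2 * e - 1) / r ^ 2 - γ / r ^ 2
        = (m - γ * 2 * (1 - e) * r) / r ^ 3 := by field_simp; ring
    have : 0 ≤ (m - γ * 2 * (1 - e) * r) / r ^ 3 := div_nonneg (by linarith) (by positivity)
    linarith
  -- zeroth order part
  have ha : γ * s ^ 4 * (3 / 4) ≤ s ^ 4 * (γ + e * (1 / 2 - 2 * γ)) + s ^ 3 * e * (1 / 4 - 2 * γ)
        - γ * s ^ 2 * e - m / (4 * r ^ 3) - γ * (2 * e - 1) / (4 * r ^ 2) := by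
    have hi : 1 / r ≤ s := by
      rw [div_le_iff₀ hr0]; linarith [mul_le_mul_of_nonneg_left hr hs0.le]
    have h2 : 1 / r ^ 2 ≤ s ^ 2 := by
      have := pow_le_pow_left₀ (by positivity) hi 2
      simpa [div_pow] using this
    have h3 : 1 / r ^ 3 ≤ s ^ 3 := by
      have := pow_le_pow_left₀ (by positivity) hi 3
      simpa [div_pow] using this
    have e1 : m / (4 * r ^ 3) = m / 4 * (1 / r ^ 3) := by field_simp
    have e2 : γ * (2 * e - 1) / (4 * r ^ 2) = γ * (2 * e - 1) / 4 * (1 / r ^ 2) := by field_simp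
    have h4 : m / 4 * (1 / r ^ 3) ≤ 2 / 4 * s ^ 3 := by
      apply mul_le_mul (by linarith) h3 (by positivity) (by norm_num)
    have h5 : γ * (2 * e - 1) / 4 * (1 / r ^ 2) ≤ 1 * s ^ 2 := by
      apply mul_le_mul _ h2 (by positivity) (by norm_num)
      linarith [mul_le_mul_of_nonneg_left he1 hγ.le]
    have h6 : γ * s ^ 2 * e ≤ s ^ 2 := by
      have : γ * e ≤ 1 := by linarith [mul_le_mul_of_nonneg_left he1 hγ.le]
      linarith [mul_le_mul_of_nonneg_right this (sq_nonneg s)]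
    have h7 : 8 * s ^ 3 ≤ γ * s ^ 4 := by
      have := mul_le_mul_of_nonneg_left hsγ (by positivity : 0 ≤ s ^ 3)
      linarith
    have h8 : 0 ≤ s ^ 4 * (e * (1 / 2 - 2 * γ)) :=
      mul_nonneg (by positivity) (mul_nonneg he0 (by linarith))
    have h9 : 0 ≤ s ^ 3 * e * (1 / 4 - 2 * γ) := mul_nonneg (by positivity) (by linarith)
    have h10 : 8 * s ^ 2 ≤ s ^ 3 := by linarith [mul_le_mul_of_nonneg_right hs (sq_nonneg s)]
    rw [e1, e2]
    linarith [sq_nonneg s]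
  have hfb : -(s ^ 2 * (f * (m * b))) ≤ 1 / 2 * f ^ 2 + s ^ 4 * m * b ^ 2 := by
    have : 0 ≤ m * (f / 2 + s ^ 2 * b) ^ 2 := mul_nonneg (by linarith) (sq_nonneg _)
    linarith [mul_le_mul_of_nonneg_right hm2 (sq_nonneg f), sq_nonneg f]
  have hfa : -(s ^ 2 * (f * (n * a))) ≤ 1 / γ * f ^ 2 + γ / 4 * s ^ 6 * a ^ 2 := by
    have h0 : 0 ≤ 1 / γ * (f + γ / 2 * (s ^ 2 * n * a)) ^ 2 := by positivity
    have h1 : 1 / γ * (f + γ / 2 * (s ^ 2 * n * a)) ^ 2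
        = 1 / γ * f ^ 2 + s ^ 2 * (f * (n * a)) + γ / 4 * s ^ 4 * a ^ 2 * n ^ 2 := by
      field_simp; ring
    have h2 : γ / 4 * s ^ 4 * a ^ 2 * n ^ 2 ≤ γ / 4 * s ^ 4 * a ^ 2 * s ^ 2 :=
      mul_le_mul_of_nonneg_left hn2 (by positivity)
    linarith
  have hγi : 1 / 2 * f ^ 2 ≤ 1 / γ * f ^ 2 := by
    apply mul_le_mul_of_nonneg_right _ (sq_nonneg f)
    rw [div_le_div_iff₀ (by norm_num) hγ]; linarith
  have hb' := mul_le_mul_of_nonneg_right hb (by positivity : 0 ≤ s ^ 2 * b ^ 2)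
  have ha' := mul_le_mul_of_nonneg_right ha (by positivity : 0 ≤ s ^ 2 * a ^ 2)
  have hc' := mul_le_mul_of_nonneg_right hc (by positivity : 0 ≤ s ^ 2 * c ^ 2)
  have e3 : γ * s ^ 2 * (c ^ 2 / r ^ 2) = γ / r ^ 2 * (s ^ 2 * c ^ 2) := by ring
  have e4 : 2 / γ * f ^ 2 = 1 / γ * f ^ 2 + 1 / γ * f ^ 2 := by ring
  rw [e3, e4, hB]
  linarith

/-- The radial flux of the multiplier identity. -/
def carlemanFlux (s m n n' r a b c : ℝ) : ℝ :=
  -(m * b ^ 2 / 2) - s ^ 4 * m * a ^ 2 / 2 + m * c ^ 2 / (2 * r ^ 2) - m * a ^ 2 / (8 * r ^ 2)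
    - n * a * b + n' * a ^ 2 / 2 + s ^ 2 * n * a ^ 2

lemma carlemanFlux_outer {ρ s ε γ a b c : ℝ} (hρ : 0 < ρ)
    (hs : 8 ≤ s) (hε : 0 < ε) (hε1 : ε ≤ 1) (hγ : 0 < γ) (hγ8 : γ ≤ 1 / 8)
    (hsε : 8 ≤ s * ε) (hsρ : 1 ≤ s * ρ) :
    -(ε * (b ^ 2 + s ^ 4 * a ^ 2)) ≤
      carlemanFlux s ε (-s / 2 + γ) (-s ^ 2 / 2 + 2 * γ * s) ρ a b c := by
  have hs0 : 0 < s := by linarith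
  unfold carlemanFlux
  have h1 : 0 ≤ ε * c ^ 2 / (2 * ρ ^ 2) := by positivity
  have hi : 1 / ρ ≤ s := by rw [div_le_iff₀ hρ]; linarith
  have h2 : 1 / ρ ^ 2 ≤ s ^ 2 := by
    have := pow_le_pow_left₀ (by positivity) hi 2
    simpa [div_pow] using this
  have h3 : ε * a ^ 2 / (8 * ρ ^ 2) ≤ s ^ 2 * a ^ 2 := by
    have : ε * a ^ 2 / (8 * ρ ^ 2) = (ε / 8) * (1 / ρ ^ 2) * a ^ 2 := by field_simp
    rw [this]
    apply mul_le_mul_of_nonneg_right _ (sq_nonneg a)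
    calc ε / 8 * (1 / ρ ^ 2) ≤ 1 * s ^ 2 := mul_le_mul (by linarith) h2 (by positivity) (by norm_num)
      _ = s ^ 2 := one_mul _
  have h4 : (-s / 2 + γ) * a * b ≤ ε / 4 * (b ^ 2 + s ^ 4 * a ^ 2) := by
    have hn : |(-s / 2 + γ)| ≤ s := by rw [abs_le]; constructor <;> linarith
    have h5 : (-s / 2 + γ) * a * b ≤ s * (|a| * |b|) := by
      calc _ ≤ |(-s / 2 + γ) * a * b| := le_abs_self _
        _ = |(-s / 2 + γ)| * (|a| * |b|) := by rw [abs_mul, abs_mul, mul_assoc]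
        _ ≤ _ := mul_le_mul_of_nonneg_right hn (by positivity)
    have h6 : s * (|a| * |b|) ≤ s * ε / 8 * (s * (|a| * |b|)) :=
      le_mul_of_one_le_left (by positivity) (by linarith)
    have h7 : s ^ 2 * (|a| * |b|) ≤ 1 / 2 * (b ^ 2 + s ^ 4 * a ^ 2) := by
      have := two_mul_le_add_sq (|b|) (s ^ 2 * |a|)
      rw [mul_pow, sq_abs, sq_abs] at this
      linarith
    have h8 := mul_le_mul_of_nonneg_left h7 (by positivity : 0 ≤ ε / 8)
    have : 0 ≤ ε * (b ^ 2 + s ^ 4 * a ^ 2) := by positivity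
    linarith
  have h9 : -(s ^ 2 / 4) * a ^ 2 ≤ (-s ^ 2 / 2 + 2 * γ * s) * a ^ 2 / 2 := by
    have : 0 ≤ γ * s * a ^ 2 := by positivity
    linarith
  have h10 : -(s ^ 3 / 2) * a ^ 2 ≤ s ^ 2 * (-s / 2 + γ) * a ^ 2 := by
    have : 0 ≤ γ * s ^ 2 * a ^ 2 := by positivity
    linarith
  have h11 : 2 * s ^ 3 * a ^ 2 ≤ ε / 4 * s ^ 4 * a ^ 2 := by
    have := mul_le_mul_of_nonneg_right hsε (by positivity : 0 ≤ s ^ 3 * a ^ 2)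
    linarith
  have h12 : 8 * s ^ 2 * a ^ 2 ≤ s ^ 3 * a ^ 2 := by
    have := mul_le_mul_of_nonneg_right hs (by positivity : 0 ≤ s ^ 2 * a ^ 2)
    linarith
  have : 0 ≤ ε * b ^ 2 := by positivity
  linarith [mul_nonneg (sq_nonneg s) (sq_nonneg a)]

lemma carlemanFlux_inner {μ s m n n' a b c : ℝ} (hμ : 0 < μ) (hs : 32 ≤ s) (hm : 1 / 2 ≤ m)
    (hm2 : m ≤ 2) (hn : |n| ≤ s) (hn' : n' ≤ s ^ 2) :
    carlemanFlux s m n n' μ a b c ≤ c ^ 2 / μ ^ 2 := by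
  have hs0 : 0 < s := by linarith
  unfold carlemanFlux
  have h1 : m * c ^ 2 / (2 * μ ^ 2) ≤ c ^ 2 / μ ^ 2 := by
    have : m * c ^ 2 / (2 * μ ^ 2) = m / 2 * (c ^ 2 / μ ^ 2) := by field_simp
    rw [this]
    exact mul_le_of_le_one_left (by positivity) (by linarith)
  have h2 : 0 ≤ m * a ^ 2 / (8 * μ ^ 2) := by positivity
  have h3 : -(n * a * b) ≤ 1 / 16 * (b ^ 2 + s ^ 4 * a ^ 2) := by
    have h5 : -(n * a * b) ≤ s * (|a| * |b|) := by
      calc _ ≤ |n * a * b| := neg_le_abs _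
        _ = |n| * (|a| * |b|) := by rw [abs_mul, abs_mul, mul_assoc]
        _ ≤ _ := mul_le_mul_of_nonneg_right hn (by positivity)
    have h6 : s * (|a| * |b|) ≤ s / 32 * (s * (|a| * |b|)) :=
      le_mul_of_one_le_left (by positivity) (by linarith)
    have h7 : s ^ 2 * (|a| * |b|) ≤ 1 / 2 * (b ^ 2 + s ^ 4 * a ^ 2) := by
      have := two_mul_le_add_sq (|b|) (s ^ 2 * |a|)
      rw [mul_pow, sq_abs, sq_abs] at this
      linarith
    have : 0 ≤ (b ^ 2 + s ^ 4 * a ^ 2) := by positivity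
    linarith
  have h4 : n' * a ^ 2 / 2 ≤ s ^ 2 * a ^ 2 := by linarith [sq_nonneg a, mul_nonneg (sq_nonneg s) (sq_nonneg a), mul_le_mul_of_nonneg_right hn' (sq_nonneg a)]
  have h5 : s ^ 2 * n * a ^ 2 ≤ s ^ 3 * a ^ 2 := by
    have := mul_le_mul_of_nonneg_right ((le_abs_self n).trans hn) (by positivity : 0 ≤ s ^ 2 * a ^ 2)
    linarith
  have h11 : 32 * s ^ 3 * a ^ 2 ≤ s ^ 4 * a ^ 2 := by
    have := mul_le_mul_of_nonneg_right hs (by positivity : 0 ≤ s ^ 3 * a ^ 2)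
    linarith
  have h12 : 32 * s ^ 2 * a ^ 2 ≤ s ^ 3 * a ^ 2 := by
    have := mul_le_mul_of_nonneg_right hs (by positivity : 0 ≤ s ^ 2 * a ^ 2)
    linarith
  have h13 : 1 / 2 * (b ^ 2 + s ^ 4 * a ^ 2) ≤ m * (b ^ 2 + s ^ 4 * a ^ 2) :=
    mul_le_mul_of_nonneg_right hm (by positivity)
  have : 0 ≤ s ^ 3 * a ^ 2 := by positivity
  linarith [sq_nonneg b]

lemma setIntegral_Icc_prod_deriv_fst {P P' : ℝ → ℝ → ℝ} {a b c d : ℝ} (hab : a ≤ b)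
    (hP : ∀ r ∈ Set.Icc a b, ∀ θ ∈ Set.Icc c d, HasDerivAt (fun r => P r θ) (P' r θ) r)
    (hc : ContinuousOn (fun p : ℝ × ℝ => P' p.1 p.2) (Set.Icc a b ×ˢ Set.Icc c d)) :
    ∫ p in Set.Icc a b ×ˢ Set.Icc c d, P' p.1 p.2 = ∫ θ in Set.Icc c d, (P b θ - P a θ) := by
  have hi := hc.integrableOn_compact (μ := volume) (isCompact_Icc.prod isCompact_Icc)
  rw [Measure.volume_eq_prod, ← setIntegral_prod_swap, setIntegral_prod]
  · apply setIntegral_congr_fun measurableSet_Icc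
    intro θ hθ
    simp only [Prod.fst_swap, Prod.snd_swap]
    rw [integral_Icc_eq_integral_Ioc, ← intervalIntegral.integral_of_le hab]
    apply intervalIntegral.integral_eq_sub_of_hasDerivAt
    · intro r hr
      rw [Set.uIcc_of_le hab] at hr
      exact hP r hr θ hθ
    · apply ContinuousOn.intervalIntegrable
      rw [Set.uIcc_of_le hab]
      exact hc.comp (by fun_prop) (fun r hr => ⟨hr, hθ⟩) (f := fun r => (r, θ))
  · have := hi.swap
    rw [← Measure.volume_eq_prod]
    exact this

lemma setIntegral_Icc_prod_deriv_snd {P P' : ℝ → ℝ → ℝ} {a b c d : ℝ} (hcd : c ≤ d)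
    (hP : ∀ r ∈ Set.Icc a b, ∀ θ ∈ Set.Icc c d, HasDerivAt (fun θ => P r θ) (P' r θ) θ)
    (hc : ContinuousOn (fun p : ℝ × ℝ => P' p.1 p.2) (Set.Icc a b ×ˢ Set.Icc c d))
    (hper : ∀ r ∈ Set.Icc a b, P r c = P r d) :
    ∫ p in Set.Icc a b ×ˢ Set.Icc c d, P' p.1 p.2 = 0 := by
  have hi := hc.integrableOn_compact (μ := volume) (isCompact_Icc.prod isCompact_Icc)
  rw [Measure.volume_eq_prod, setIntegral_prod _ (by rwa [← Measure.volume_eq_prod])]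
  rw [← integral_zero ℝ ℝ (μ := volume.restrict (Set.Icc a b))]
  apply setIntegral_congr_fun measurableSet_Icc
  intro r hr
  simp only
  rw [integral_Icc_eq_integral_Ioc, ← intervalIntegral.integral_of_le hcd,
    intervalIntegral.integral_eq_sub_of_hasDerivAt (f := fun θ => P r θ), hper r hr, sub_self]
  · intro θ hθ
    rw [Set.uIcc_of_le hcd] at hθ
    exact hP r hr θ hθ
  · apply ContinuousOn.intervalIntegrable
    rw [Set.uIcc_of_le hcd]
    exact hc.comp (by fun_prop) (fun θ hθ => ⟨hr, hθ⟩) (f := fun θ => (r, θ))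

lemma sq_le_integral_deriv_sq {h h' : ℝ → ℝ} {a b : ℝ} (hab : a ≤ b)
    (hd : ∀ r ∈ Set.Icc a b, HasDerivAt h (h' r) r) (hc : ContinuousOn h' (Set.Icc a b)) :
    (h b - h a) ^ 2 ≤ (b - a) * ∫ r in a..b, h' r ^ 2 := by
  rcases hab.eq_or_lt with rfl | hlt
  · simp
  have hi : IntervalIntegrable h' volume a b :=
    ContinuousOn.intervalIntegrable (by rwa [Set.uIcc_of_le hab])
  have hi2 : IntervalIntegrable (fun r => h' r ^ 2) volume a b :=
    ContinuousOn.intervalIntegrable (by rw [Set.uIcc_of_le hab]; exact hc.pow 2)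
  have hF : ∫ r in a..b, h' r = h b - h a :=
    intervalIntegral.integral_eq_sub_of_hasDerivAt
      (fun r hr => hd r (by rwa [Set.uIcc_of_le hab] at hr)) hi
  have h0 : 0 ≤ ∫ r in a..b, ((b - a) * h' r - (h b - h a)) ^ 2 :=
    intervalIntegral.integral_nonneg hab fun _ _ => sq_nonneg _
  have h1 : ∫ r in a..b, ((b - a) * h' r - (h b - h a)) ^ 2
      = (b - a) ^ 2 * (∫ r in a..b, h' r ^ 2) - 2 * (b - a) * (h b - h a) * (h b - h a)
        + (b - a) * (h b - h a) ^ 2 := by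
    have e : (fun r => ((b - a) * h' r - (h b - h a)) ^ 2) = fun r =>
        (b - a) ^ 2 * h' r ^ 2 - 2 * (b - a) * (h b - h a) * h' r + (h b - h a) ^ 2 := by
      ext r; ring
    rw [e, intervalIntegral.integral_add ((hi2.const_mul _).sub (hi.const_mul _)) (by simp),
      intervalIntegral.integral_sub (hi2.const_mul _) (hi.const_mul _),
      intervalIntegral.integral_const_mul, intervalIntegral.integral_const_mul, hF,
      intervalIntegral.integral_const]
    simp
  have h2 : 0 < b - a := by linarith
  rw [h1] at h0
  have : 0 ≤ (b - a) * ((b - a) * (∫ r in a..b, h' r ^ 2) - (h b - h a) ^ 2) := by nlinarith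
  have := nonneg_of_mul_nonneg_right this h2
  linarith

lemma weighted_trace {h h' : ℝ → ℝ} {μ ρ l lam : ℝ} (hl : 0 < l) (hlρ : μ + l ≤ ρ)
    (hlam : 0 < lam)
    (hd : ∀ r ∈ Set.Icc μ ρ, HasDerivAt h (h' r) r) (hc : ContinuousOn h' (Set.Icc μ ρ)) :
    lam * l ^ 2 * h μ ^ 2 * exp (2 * lam * μ) ≤
      2 * (∫ r in Set.Icc μ ρ, h r ^ 2 * exp (2 * lam * r))
        + 2 * l * (lam * l ^ 2) * exp (2 * lam * μ) * ∫ r in Set.Icc μ ρ, h' r ^ 2 := by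
  have hμρ : μ ≤ ρ := by linarith
  have hhc : ContinuousOn h (Set.Icc μ ρ) := fun r hr => (hd r hr).continuousAt.continuousWithinAt
  have hI2 : IntegrableOn (fun r => h' r ^ 2) (Set.Icc μ ρ) := (hc.pow 2).integrableOn_Icc
  have hIE : IntegrableOn (fun r => h r ^ 2 * exp (2 * lam * r)) (Set.Icc μ ρ) :=
    ((hhc.pow 2).mul (by fun_prop)).integrableOn_Icc
  set I := ∫ r in Set.Icc μ ρ, h' r ^ 2 with hI
  have hpt : ∀ r ∈ Set.Icc μ (μ + l),
      (2 * lam * (r - μ)) * (h μ ^ 2 * exp (2 * lam * μ)) ≤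
        2 * (h r ^ 2 * exp (2 * lam * r)) + (2 * lam * (r - μ)) * (2 * l * I * exp (2 * lam * μ)) := by
    intro r hr
    have hsub : Set.Icc μ r ⊆ Set.Icc μ ρ := Set.Icc_subset_Icc_right (by linarith [hr.2])
    have h1 := sq_le_integral_deriv_sq hr.1 (fun x hx => hd x (hsub hx)) (hc.mono hsub)
    have h2 : ∫ x in μ..r, h' x ^ 2 ≤ I := by
      rw [intervalIntegral.integral_of_le hr.1, ← integral_Icc_eq_integral_Ioc]
      exact setIntegral_mono_set hI2 (Filter.Eventually.of_forall fun _ => sq_nonneg _)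
        hsub.eventuallyLE
    have hI0 : 0 ≤ I := integral_nonneg fun _ => sq_nonneg _
    have h3 : (r - μ) * ∫ x in μ..r, h' x ^ 2 ≤ l * I := by
      apply mul_le_mul (by linarith [hr.2]) h2 _ hl.le
      exact intervalIntegral.integral_nonneg hr.1 fun _ _ => sq_nonneg _
    have h4 : h μ ^ 2 ≤ 2 * h r ^ 2 + 2 * l * I := by nlinarith [sq_nonneg (2 * h r - h μ)]
    have h5 : (2 * lam * (r - μ)) * exp (2 * lam * μ) ≤ exp (2 * lam * r) := by
      have : exp (2 * lam * r) = exp (2 * lam * (r - μ)) * exp (2 * lam * μ) := by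
        rw [← exp_add]; ring_nf
      rw [this]
      apply mul_le_mul_of_nonneg_right _ (exp_pos _).le
      linarith [add_one_le_exp (2 * lam * (r - μ))]
    have h6 : 0 ≤ (2 * lam * (r - μ)) * exp (2 * lam * μ) :=
      mul_nonneg (mul_nonneg (by positivity) (by linarith [hr.1])) (exp_pos _).le
    have h7 := mul_le_mul_of_nonneg_left h4 h6
    have h8 := mul_le_mul_of_nonneg_right h5 (by positivity : 0 ≤ 2 * h r ^ 2)
    nlinarith
  have hsub : Set.Icc μ (μ + l) ⊆ Set.Icc μ ρ := Set.Icc_subset_Icc_right hlρ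
  have hgint : ∀ A : ℝ, ∫ r in Set.Icc μ (μ + l), (2 * lam * (r - μ)) * A = lam * l ^ 2 * A := by
    intro A
    rw [integral_Icc_eq_integral_Ioc, ← intervalIntegral.integral_of_le (by linarith),
      intervalIntegral.integral_eq_sub_of_hasDerivAt (f := fun r => lam * (r - μ) ^ 2 * A)]
    · ring
    · intro r _
      have := ((((hasDerivAt_id r).sub_const μ).pow 2).const_mul lam).mul_const A
      refine this.congr_deriv ?_
      push_cast
      simp only [id]
      ring
    · exact Continuous.intervalIntegrable (by fun_prop) _ _
  have hmono := setIntegral_mono_on (μ := volume)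
    (Continuous.integrableOn_Icc (by fun_prop) :
      IntegrableOn (fun r => (2 * lam * (r - μ)) * (h μ ^ 2 * exp (2 * lam * μ))) (Set.Icc μ (μ + l)))
    (((hIE.mono_set hsub).const_mul 2).add (Continuous.integrableOn_Icc (by fun_prop)))
    measurableSet_Icc hpt
  simp only [Pi.add_apply] at hmono
  rw [hgint, integral_add ((hIE.mono_set hsub).const_mul 2)
    (Continuous.integrableOn_Icc (by fun_prop)), hgint, integral_const_mul] at hmono
  have h9 : ∫ r in Set.Icc μ (μ + l), h r ^ 2 * exp (2 * lam * r)
      ≤ ∫ r in Set.Icc μ ρ, h r ^ 2 * exp (2 * lam * r) :=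
    setIntegral_mono_set hIE (Filter.Eventually.of_forall fun _ => by positivity)
      hsub.eventuallyLE
  nlinarith

lemma hasDerivAt_carlemanFlux {m n k a b c : ℝ → ℝ} {m' n' k' a' b' c' r : ℝ} (s : ℝ) (hr : r ≠ 0)
    (hm : HasDerivAt m m' r) (hn : HasDerivAt n n' r) (hk : HasDerivAt k k' r)
    (ha : HasDerivAt a a' r) (hb : HasDerivAt b b' r) (hc : HasDerivAt c c' r) :
    HasDerivAt (fun x => carlemanFlux s (m x) (n x) (k x) x (a x) (b x) (c x))
      (-(m' * b r ^ 2 / 2 + m r * b r * b') - s ^ 4 * (m' * a r ^ 2 / 2 + m r * a r * a')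
        + (m' * c r ^ 2 / (2 * r ^ 2) + m r * c r * c' / r ^ 2 - m r * c r ^ 2 / r ^ 3)
        - (m' * a r ^ 2 / (8 * r ^ 2) + m r * a r * a' / (4 * r ^ 2) - m r * a r ^ 2 / (4 * r ^ 3))
        - (n' * a r * b r + n r * a' * b r + n r * a r * b')
        + (k' * a r ^ 2 / 2 + k r * a r * a')
        + s ^ 2 * (n' * a r ^ 2 + 2 * n r * a r * a')) r := by
  unfold carlemanFlux
  have hid := hasDerivAt_id r
  have h2 : (2 : ℝ) * r ^ 2 ≠ 0 := by positivity
  have h8 : (8 : ℝ) * r ^ 2 ≠ 0 := by positivity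
  have := (((((((hm.mul (hb.pow 2)).div_const 2).neg.sub
    (((hm.const_mul (s ^ 4)).mul (ha.pow 2)).div_const 2)).add
    ((hm.mul (hc.pow 2)).div ((hid.pow 2).const_mul 2) h2)).sub
    ((hm.mul (ha.pow 2)).div ((hid.pow 2).const_mul 8) h8)).sub
    ((hn.mul ha).mul hb)).add ((hk.mul (ha.pow 2)).div_const 2)).add
    ((hn.const_mul (s ^ 2)).mul (ha.pow 2))
  refine this.congr_deriv ?_
  simp only [Pi.mul_apply, Pi.pow_apply, id]
  push_cast
  field_simp
  ring

lemma carleman_on_rectangle {μ ρ s ε γ : ℝ} (hμ : 0 < μ) (hμρ : μ < ρ)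
    (hs : 32 ≤ s) (hε : 0 < ε) (hε1 : ε ≤ 1) (hγ : 0 < γ) (hγ8 : γ ≤ 1 / 8) (hγρ : γ * (2 * ρ) ≤ 1)
    (hsε : 8 ≤ s * ε) (hsγ : 8 ≤ s * γ) (hsμ : 1 ≤ s * μ) (hsμρ : 1 ≤ s * (ρ - μ))
    {v vr vt vrr vrt vtt : ℝ → ℝ → ℝ} {K : Set (ℝ × ℝ)}
    (hK : K = Set.Icc μ ρ ×ˢ Set.Icc (-π) π)
    (cv : ContinuousOn (fun p : ℝ × ℝ => v p.1 p.2) K)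
    (cvr : ContinuousOn (fun p : ℝ × ℝ => vr p.1 p.2) K)
    (cvt : ContinuousOn (fun p : ℝ × ℝ => vt p.1 p.2) K)
    (cvrr : ContinuousOn (fun p : ℝ × ℝ => vrr p.1 p.2) K)
    (cvrt : ContinuousOn (fun p : ℝ × ℝ => vrt p.1 p.2) K)
    (cvtt : ContinuousOn (fun p : ℝ × ℝ => vtt p.1 p.2) K)
    (dr : ∀ r ∈ Set.Icc μ ρ, ∀ θ, HasDerivAt (fun r => v r θ) (vr r θ) r)
    (drr : ∀ r ∈ Set.Icc μ ρ, ∀ θ, HasDerivAt (fun r => vr r θ) (vrr r θ) r)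
    (dtr : ∀ r ∈ Set.Icc μ ρ, ∀ θ, HasDerivAt (fun r => vt r θ) (vrt r θ) r)
    (dt : ∀ r ∈ Set.Icc μ ρ, ∀ θ, HasDerivAt (fun θ => v r θ) (vt r θ) θ)
    (drt : ∀ r ∈ Set.Icc μ ρ, ∀ θ, HasDerivAt (fun θ => vr r θ) (vrt r θ) θ)
    (dtt : ∀ r ∈ Set.Icc μ ρ, ∀ θ, HasDerivAt (fun θ => vt r θ) (vtt r θ) θ)
    (pv : ∀ r, v r (-π) = v r π) (pvr : ∀ r, vr r (-π) = vr r π) (pvt : ∀ r, vt r (-π) = vt r π) :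
    ∫ p in K, (γ / 2 * s ^ 6 * v p.1 p.2 ^ 2 + ε / 2 * s ^ 4 * vr p.1 p.2 ^ 2
        + γ * s ^ 2 * (vt p.1 p.2 ^ 2 / p.1 ^ 2)) ≤
      2 / γ * (∫ p in K, (vrr p.1 p.2 - 2 * s ^ 2 * vr p.1 p.2 + s ^ 4 * v p.1 p.2
        + vtt p.1 p.2 / p.1 ^ 2 + v p.1 p.2 / (4 * p.1 ^ 2)) ^ 2)
      + s ^ 2 * ε * (∫ θ in Set.Icc (-π) π, (vr ρ θ ^ 2 + s ^ 4 * v ρ θ ^ 2))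
      + s ^ 2 / μ ^ 2 * ∫ θ in Set.Icc (-π) π, vt μ θ ^ 2 := by
  have hs0 : 0 < s := by linarith
  have hρ : 0 < ρ := by linarith
  have hπ : -π ≤ π := by linarith [pi_pos]
  have hKc : IsCompact K := hK ▸ isCompact_Icc.prod isCompact_Icc
  have hKm : MeasurableSet K := hK ▸ measurableSet_Icc.prod measurableSet_Icc
  have hK1 : ∀ p ∈ K, p.1 ∈ Set.Icc μ ρ := fun p hp => by rw [hK] at hp; exact hp.1
  have hKne : ∀ p ∈ K, p.1 ≠ 0 := fun p hp => by linarith [(hK1 p hp).1]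
  have hKne2 : ∀ p ∈ K, p.1 ^ 2 ≠ 0 := fun p hp => pow_ne_zero _ (hKne p hp)
  have hKne3 : ∀ p ∈ K, p.1 ^ 3 ≠ 0 := fun p hp => pow_ne_zero _ (hKne p hp)
  have hKne4 : ∀ p ∈ K, 4 * p.1 ^ 2 ≠ 0 := fun p hp => mul_ne_zero (by norm_num) (hKne2 p hp)
  have hKne5 : ∀ p ∈ K, 4 * p.1 ^ 3 ≠ 0 := fun p hp => mul_ne_zero (by norm_num) (hKne3 p hp)
  let e : ℝ → ℝ := fun r => exp (s * (r - ρ))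
  have ce : Continuous e := by fun_prop
  have he' : ∀ r, HasDerivAt e (s * e r) r := fun r => by
    have := (((hasDerivAt_id r).sub_const ρ).const_mul s).exp
    refine this.congr_deriv ?_
    simp [e, mul_comm]
  have he0 : ∀ r, 0 ≤ e r := fun r => (exp_pos _).le
  have he1 : ∀ r ≤ ρ, e r ≤ 1 := fun r hr => by
    apply exp_le_one_iff.2; exact mul_nonpos_of_nonneg_of_nonpos hs0.le (by linarith)
  let m : ℝ → ℝ := fun r => 1 + ε - e r
  let n : ℝ → ℝ := fun r => -(s * e r) / 2 + γ * (2 * e r - 1)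
  let k : ℝ → ℝ := fun r => -(s ^ 2 * e r) / 2 + 2 * γ * s * e r
  let f : ℝ → ℝ → ℝ := fun r θ => vrr r θ - 2 * s ^ 2 * vr r θ + s ^ 4 * v r θ
        + vtt r θ / r ^ 2 + v r θ / (4 * r ^ 2)
  let Q' : ℝ → ℝ → ℝ := fun r θ => -(m r * (vrt r θ * vt r θ + vr r θ * vtt r θ)
    + n r * (vt r θ * vt r θ + v r θ * vtt r θ)) / r ^ 2
  let B : ℝ → ℝ → ℝ := fun r θ => 
    (2 * s ^ 2 * (1 + ε - e r) - s * e r + γ * (2 * e r - 1)) * vr r θ ^ 2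
      + (s ^ 4 * (γ + e r * (1 / 2 - 2 * γ)) + s ^ 3 * e r * (1 / 4 - 2 * γ) - γ * s ^ 2 * e r
        - (1 + ε - e r) / (4 * r ^ 3) - γ * (2 * e r - 1) / (4 * r ^ 2)) * v r θ ^ 2
      + ((1 + ε - e r) / r ^ 3 + γ * (2 * e r - 1) / r ^ 2) * vt r θ ^ 2
  let P' : ℝ → ℝ → ℝ := fun r θ =>
    -(f r θ * (m r * vr r θ + n r * v r θ)) - Q' r θ - B r θ
  let P : ℝ → ℝ → ℝ := fun r θ =>
    carlemanFlux s (m r) (n r) (k r) r (v r θ) (vr r θ) (vt r θ)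
  have cf : ContinuousOn (fun p : ℝ × ℝ => f p.1 p.2) K := by
    simp only [f]
    fun_prop (disch := assumption)
  have cQ' : ContinuousOn (fun p : ℝ × ℝ => Q' p.1 p.2) K := by
    simp only [Q', m, n]
    fun_prop (disch := assumption)
  have cB : ContinuousOn (fun p : ℝ × ℝ => B p.1 p.2) K := by
    simp only [B]
    fun_prop (disch := assumption)
  have cP' : ContinuousOn (fun p : ℝ × ℝ => P' p.1 p.2) K := by
    simp only [P', m, n]
    fun_prop (disch := assumption)
  have hm' : ∀ r, HasDerivAt m (-(s * e r)) r := fun r => (he' r).const_sub _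
  have hn' : ∀ r, HasDerivAt n (k r) r := fun r => by
    have := (((he' r).const_mul s).neg.div_const 2).add ((((he' r).const_mul 2).sub_const 1).const_mul γ)
    exact this.congr_deriv (by simp only [k]; ring)
  have hk' : ∀ r, HasDerivAt k (-(s ^ 3 * e r) / 2 + 2 * γ * s ^ 2 * e r) r := fun r => by
    have := (((he' r).const_mul (s ^ 2)).neg.div_const 2).add ((he' r).const_mul (2 * γ * s))
    exact this.congr_deriv (by ring)
  have hP : ∀ r ∈ Set.Icc μ ρ, ∀ θ ∈ Set.Icc (-π) π, HasDerivAt (fun r => P r θ) (P' r θ) r := by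
    intro r hr θ _
    have hr0 : r ≠ 0 := by linarith [hr.1]
    refine (hasDerivAt_carlemanFlux s hr0 (hm' r) (hn' r) (hk' r) (dr r hr θ) (drr r hr θ)
      (dtr r hr θ)).congr_deriv ?_
    simp only [P', Q', B, f, m, n, k]
    field_simp
    ring
  have hQ : ∀ r ∈ Set.Icc μ ρ, ∀ θ ∈ Set.Icc (-π) π,
      HasDerivAt (fun θ => -(m r * (vr r θ * vt r θ) + n r * (v r θ * vt r θ)) / r ^ 2)
        (Q' r θ) θ := by
    intro r hr θ _
    have := ((((drt r hr θ).mul (dtt r hr θ)).const_mul (m r)).add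
      (((dt r hr θ).mul (dtt r hr θ)).const_mul (n r))).neg.div_const (r ^ 2)
    exact this
  have iP := setIntegral_Icc_prod_deriv_fst hμρ.le hP (hK ▸ cP')
  have iQ := setIntegral_Icc_prod_deriv_snd hπ hQ (hK ▸ cQ') (fun r _ => by rw [pv, pvr, pvt])
  rw [← hK] at iP iQ
  have cslice : ∀ {g : ℝ → ℝ → ℝ}, ContinuousOn (fun p : ℝ × ℝ => g p.1 p.2) K →
      ∀ r ∈ Set.Icc μ ρ, ContinuousOn (g r) (Set.Icc (-π) π) := fun hg r hr =>
    hg.comp (f := fun θ => (r, θ)) (by fun_prop) (fun θ hθ => by rw [hK]; exact ⟨hr, hθ⟩)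
  have hbd : -(ε * (∫ θ in Set.Icc (-π) π, (vr ρ θ ^ 2 + s ^ 4 * v ρ θ ^ 2)))
      - 1 / μ ^ 2 * (∫ θ in Set.Icc (-π) π, vt μ θ ^ 2)
      ≤ ∫ θ in Set.Icc (-π) π, (P ρ θ - P μ θ) := by
    have hρm : ρ ∈ Set.Icc μ ρ := ⟨hμρ.le, le_rfl⟩
    have hμm : μ ∈ Set.Icc μ ρ := ⟨le_rfl, hμρ.le⟩
    have c1 := cslice cv ρ hρm
    have c2 := cslice cvr ρ hρm
    have c3 := cslice cvt ρ hρm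
    have c4 := cslice cv μ hμm
    have c5 := cslice cvr μ hμm
    have c6 := cslice cvt μ hμm
    have i1 : IntegrableOn (fun θ => vr ρ θ ^ 2 + s ^ 4 * v ρ θ ^ 2) (Set.Icc (-π) π) :=
      ContinuousOn.integrableOn_Icc (by fun_prop)
    have i2 : IntegrableOn (fun θ => vt μ θ ^ 2) (Set.Icc (-π) π) :=
      ContinuousOn.integrableOn_Icc (by fun_prop)
    rw [← integral_const_mul, ← integral_const_mul, ← integral_neg, ← integral_sub]
    · apply setIntegral_mono_on
      · exact (i1.const_mul ε).neg.sub (i2.const_mul _)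
      · apply ContinuousOn.integrableOn_Icc
        simp only [P, carlemanFlux]
        fun_prop
      · exact measurableSet_Icc
      · intro θ _
        have eρ : e ρ = 1 := by simp [e]
        have h1 : -(ε * (vr ρ θ ^ 2 + s ^ 4 * v ρ θ ^ 2)) ≤ P ρ θ := by
          have := carlemanFlux_outer (ρ := ρ) (a := v ρ θ) (b := vr ρ θ) (c := vt ρ θ) hρ
            (by linarith) hε hε1 hγ hγ8 hsε
            (by linarith [mul_le_mul_of_nonneg_left hμρ.le hs0.le])
          refine this.trans (le_of_eq ?_)
          simp only [P, m, n, k, eρ]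
          congr 1 <;> ring
        have h2 : P μ θ ≤ 1 / μ ^ 2 * vt μ θ ^ 2 := by
          have e0 := he0 μ
          have e1 : e μ ≤ 1 / 2 := by
            have : e μ ≤ exp (-1) := exp_le_exp.2 (by linarith)
            linarith [exp_neg_one_lt_half]
          have h3 : 0 ≤ s * e μ := mul_nonneg hs0.le e0
          have h4 : s * e μ ≤ s * (1 / 2) := mul_le_mul_of_nonneg_left e1 hs0.le
          have h5 : 0 ≤ γ * e μ := mul_nonneg hγ.le e0
          have h6 : γ * e μ ≤ γ * (1 / 2) := mul_le_mul_of_nonneg_left e1 hγ.le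
          have := carlemanFlux_inner (s := s) (m := m μ) (n := n μ) (n' := k μ) (a := v μ θ)
            (b := vr μ θ) (c := vt μ θ) hμ hs
            (by simp only [m]; linarith) (by simp only [m]; linarith)
            (by simp only [n]; rw [abs_le]; constructor <;> linarith)
            (by
              simp only [k]
              have h7 : γ * (s * e μ) ≤ 1 * (s * e μ) :=
                mul_le_mul_of_nonneg_right (by linarith) h3
              nlinarith [mul_nonneg hs0.le h3])
          refine this.trans (le_of_eq (by ring))
        linarith
    · exact (i1.const_mul ε).neg
    · exact i2.const_mul _
  have jint : ∀ {g : ℝ × ℝ → ℝ}, ContinuousOn g K → IntegrableOn g K := fun hg =>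
    hg.integrableOn_compact hKc
  have hmain : ∫ p in K, (γ / 2 * s ^ 6 * v p.1 p.2 ^ 2 + ε / 2 * s ^ 4 * vr p.1 p.2 ^ 2
        + γ * s ^ 2 * (vt p.1 p.2 ^ 2 / p.1 ^ 2)) ≤
      ∫ p in K, (2 / γ * f p.1 p.2 ^ 2 - s ^ 2 * (P' p.1 p.2 + Q' p.1 p.2)) := by
    apply setIntegral_mono_on
    · apply jint
      fun_prop (disch := assumption)
    · apply jint
      fun_prop (disch := assumption)
    · exact hKm
    · intro p hp
      have hr := hK1 p hp
      have := bulk_lower_bound (f := f p.1 p.2) (a := v p.1 p.2) (b := vr p.1 p.2)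
        (c := vt p.1 p.2) hμ hr.1 hr.2 (by linarith) hε hε1 hγ hγ8 hγρ hsε hsγ hsμ
        (he0 p.1) (he1 _ hr.2) rfl
      refine this.trans (le_of_eq ?_)
      simp only [P', B, m, n]
      ring
  have c1 : ContinuousOn (fun p : ℝ × ℝ => 2 / γ * f p.1 p.2 ^ 2) K := by fun_prop
  have c2 : ContinuousOn (fun p : ℝ × ℝ => s ^ 2 * (P' p.1 p.2 + Q' p.1 p.2)) K := by fun_prop
  rw [integral_sub (jint c1) (jint c2), integral_const_mul, integral_const_mul,
    integral_add (jint cP') (jint cQ'), iP, iQ] at hmain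
  have := mul_le_mul_of_nonneg_left hbd (sq_nonneg s)
  simp only [f] at hmain
  have e1 : s ^ 2 / μ ^ 2 = s ^ 2 * (1 / μ ^ 2) := by ring
  rw [e1]
  linarith

/-- The outward radial unit vector at angle `θ`. -/
def radialVec (θ : ℝ) : EuclideanSpace ℝ (Fin 2) := !₂[cos θ, sin θ]

/-- The tangential unit vector at angle `θ`. -/
def tangentVec (θ : ℝ) : EuclideanSpace ℝ (Fin 2) := !₂[-sin θ, cos θ]

lemma radialVec_eq (θ : ℝ) : radialVec θ =
    cos θ • EuclideanSpace.single 0 1 + sin θ • EuclideanSpace.single 1 1 := by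
  ext i; fin_cases i <;> simp [radialVec]

lemma tangentVec_eq (θ : ℝ) : tangentVec θ =
    (-sin θ) • EuclideanSpace.single 0 1 + cos θ • EuclideanSpace.single 1 1 := by
  ext i; fin_cases i <;> simp [tangentVec]

lemma hasDerivAt_radialVec (θ : ℝ) : HasDerivAt radialVec (tangentVec θ) θ := by
  rw [funext radialVec_eq, tangentVec_eq]
  exact ((hasDerivAt_cos θ).smul_const _).add ((hasDerivAt_sin θ).smul_const _)

lemma hasDerivAt_tangentVec (θ : ℝ) : HasDerivAt tangentVec (-radialVec θ) θ := by
  rw [funext tangentVec_eq, radialVec_eq, neg_add, ← neg_smul, ← neg_smul]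
  exact ((hasDerivAt_sin θ).neg.smul_const _).add ((hasDerivAt_cos θ).smul_const _)

lemma continuous_radialVec : Continuous radialVec :=
  continuous_iff_continuousAt.2 fun θ => (hasDerivAt_radialVec θ).continuousAt

lemma continuous_tangentVec : Continuous tangentVec :=
  continuous_iff_continuousAt.2 fun θ => (hasDerivAt_tangentVec θ).continuousAt

@[simp] lemma norm_radialVec (θ : ℝ) : ‖radialVec θ‖ = 1 := by
  simp [EuclideanSpace.norm_eq, radialVec, Fin.sum_univ_two]

@[simp] lemma norm_tangentVec (θ : ℝ) : ‖tangentVec θ‖ = 1 := by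
  simp [EuclideanSpace.norm_eq, tangentVec, Fin.sum_univ_two]

lemma radialVec_neg_pi : radialVec (-π) = radialVec π := by simp [radialVec]

lemma tangentVec_neg_pi : tangentVec (-π) = tangentVec π := by simp [tangentVec]

section PolarDerivatives

variable {w : EuclideanSpace ℝ (Fin 2) → ℝ}

lemma hasFDerivAt_of_contDiff_two (hw : ContDiff ℝ 2 w) (x : EuclideanSpace ℝ (Fin 2)) :
    HasFDerivAt w (fderiv ℝ w x) x :=
  (hw.differentiable (by norm_num) x).hasFDerivAt

lemma contDiff_one_fderiv (hw : ContDiff ℝ 2 w) : ContDiff ℝ 1 (fderiv ℝ w) :=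
  hw.fderiv_right (by norm_num)

lemma hasFDerivAt_fderiv (hw : ContDiff ℝ 2 w) (x : EuclideanSpace ℝ (Fin 2)) :
    HasFDerivAt (fderiv ℝ w) (fderiv ℝ (fderiv ℝ w) x) x :=
  ((contDiff_one_fderiv hw).differentiable (by norm_num) x).hasFDerivAt

lemma hasDerivAt_smul_radialVec (r θ : ℝ) :
    HasDerivAt (fun r : ℝ => r • radialVec θ) (radialVec θ) r := by
  simpa using (hasDerivAt_id r).smul_const (radialVec θ)

lemma hasDerivAt_smul_radialVec_angle (r θ : ℝ) :
    HasDerivAt (fun θ => r • radialVec θ) (r • tangentVec θ) θ :=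
  (hasDerivAt_radialVec θ).const_smul r

lemma polar_hasDerivAt_fst (hw : ContDiff ℝ 2 w) (r θ : ℝ) :
    HasDerivAt (fun r : ℝ => w (r • radialVec θ)) (fderiv ℝ w (r • radialVec θ) (radialVec θ)) r :=
  (hasFDerivAt_of_contDiff_two hw _).comp_hasDerivAt r (hasDerivAt_smul_radialVec r θ)

lemma polar_hasDerivAt_snd (hw : ContDiff ℝ 2 w) (r θ : ℝ) :
    HasDerivAt (fun θ => w (r • radialVec θ))
      (r * fderiv ℝ w (r • radialVec θ) (tangentVec θ)) θ := by
  have := (hasFDerivAt_of_contDiff_two hw _).comp_hasDerivAt θ (hasDerivAt_smul_radialVec_angle r θ)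
  exact this.congr_deriv (by simp)

lemma polar_hasDerivAt_fderiv_fst (hw : ContDiff ℝ 2 w) (r θ : ℝ) (u : EuclideanSpace ℝ (Fin 2)) :
    HasDerivAt (fun r : ℝ => fderiv ℝ w (r • radialVec θ) u)
      (fderiv ℝ (fderiv ℝ w) (r • radialVec θ) (radialVec θ) u) r := by
  have := (hasFDerivAt_fderiv hw _).comp_hasDerivAt r (hasDerivAt_smul_radialVec r θ)
  exact (this.clm_apply (hasDerivAt_const r u)).congr_deriv (by simp)

lemma polar_hasDerivAt_fderiv_radial (hw : ContDiff ℝ 2 w) (r θ : ℝ) :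
    HasDerivAt (fun θ => fderiv ℝ w (r • radialVec θ) (radialVec θ))
      (r * fderiv ℝ (fderiv ℝ w) (r • radialVec θ) (radialVec θ) (tangentVec θ)
        + fderiv ℝ w (r • radialVec θ) (tangentVec θ)) θ := by
  have := (hasFDerivAt_fderiv hw _).comp_hasDerivAt θ (hasDerivAt_smul_radialVec_angle r θ)
  refine (this.clm_apply (hasDerivAt_radialVec θ)).congr_deriv ?_
  have hsymm : IsSymmSndFDerivAt ℝ w (r • radialVec θ) :=
    hw.contDiffAt.isSymmSndFDerivAt (by simp)
  simp [hsymm (tangentVec θ) (radialVec θ)]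

lemma polar_hasDerivAt_fderiv_tangent (hw : ContDiff ℝ 2 w) (r θ : ℝ) :
    HasDerivAt (fun θ => r * fderiv ℝ w (r • radialVec θ) (tangentVec θ))
      (r ^ 2 * fderiv ℝ (fderiv ℝ w) (r • radialVec θ) (tangentVec θ) (tangentVec θ)
        - r * fderiv ℝ w (r • radialVec θ) (radialVec θ)) θ := by
  have := (hasFDerivAt_fderiv hw _).comp_hasDerivAt θ (hasDerivAt_smul_radialVec_angle r θ)
  refine ((this.clm_apply (hasDerivAt_tangentVec θ)).const_mul r).congr_deriv ?_
  simp
  ring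

lemma lap2_smul_radialVec (hw : ContDiff ℝ 2 w) (x : EuclideanSpace ℝ (Fin 2)) (θ : ℝ) :
    lap2 w x = fderiv ℝ (fderiv ℝ w) x (radialVec θ) (radialVec θ)
      + fderiv ℝ (fderiv ℝ w) x (tangentVec θ) (tangentVec θ) := by
  have h : ∀ u : EuclideanSpace ℝ (Fin 2),
      fderiv ℝ (fun y => fderiv ℝ w y u) x u = fderiv ℝ (fderiv ℝ w) x u u := fun u => by
    have := (hasFDerivAt_fderiv hw x).clm_apply (hasFDerivAt_const u x)
    rw [this.fderiv]
    simp
  simp only [lap2, Fin.sum_univ_two, h]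
  rw [radialVec_eq, tangentVec_eq]
  simp only [map_add, map_smul, add_apply, smul_apply,
    smul_eq_mul]
  have := sin_sq_add_cos_sq θ
  linear_combination (-(fderiv ℝ (fderiv ℝ w) x (EuclideanSpace.single 0 1) (EuclideanSpace.single 0 1))
    - (fderiv ℝ (fderiv ℝ w) x (EuclideanSpace.single 1 1) (EuclideanSpace.single 1 1))) * this

lemma norm_gradient_sq_eq (x : EuclideanSpace ℝ (Fin 2)) (θ : ℝ) :
    ‖gradient w x‖ ^ 2 = fderiv ℝ w x (radialVec θ) ^ 2 + fderiv ℝ w x (tangentVec θ) ^ 2 := by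
  have h : ∀ u, fderiv ℝ w x u = inner ℝ (gradient w x) u := fun u => by
    simp [gradient]
  rw [h, h, EuclideanSpace.real_norm_sq_eq]
  simp only [Fin.sum_univ_two, PiLp.inner_apply, radialVec, tangentVec]
  simp
  have := sin_sq_add_cos_sq θ
  linear_combination (-(gradient w x 0) ^ 2 - (gradient w x 1) ^ 2) * this

/-- The Riesz isomorphism of the Euclidean plane as a real-linear continuous map. -/
def dualToPlane : (EuclideanSpace ℝ (Fin 2) →L[ℝ] ℝ) →L[ℝ] EuclideanSpace ℝ (Fin 2) :=
  ∑ i : Fin 2, (ContinuousLinearMap.apply ℝ ℝ (EuclideanSpace.single i (1 : ℝ))).smulRight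
    (EuclideanSpace.single i (1 : ℝ))

lemma inner_dualToPlane (φ : EuclideanSpace ℝ (Fin 2) →L[ℝ] ℝ) (v : EuclideanSpace ℝ (Fin 2)) :
    inner ℝ (dualToPlane φ) v = φ v := by
  have hv : v = v 0 • EuclideanSpace.single 0 1 + v 1 • EuclideanSpace.single 1 1 := by
    ext i; fin_cases i <;> simp
  conv_rhs => rw [hv]
  simp [dualToPlane, Fin.sum_univ_two, PiLp.inner_apply]
  

lemma gradient_eq_dualToPlane : gradient w = fun x => dualToPlane (fderiv ℝ w x) := by
  funext x
  refine ext_inner_right ℝ fun v => ?_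
  rw [inner_dualToPlane]
  simp [gradient]

lemma hasFDerivAt_gradient (hw : ContDiff ℝ 2 w) (x : EuclideanSpace ℝ (Fin 2)) :
    HasFDerivAt (gradient w) (dualToPlane.comp (fderiv ℝ (fderiv ℝ w) x)) x := by
  rw [gradient_eq_dualToPlane]
  exact dualToPlane.hasFDerivAt.comp x (hasFDerivAt_fderiv hw x)

lemma fderiv_fderiv_apply_sq_le (hw : ContDiff ℝ 2 w) (x : EuclideanSpace ℝ (Fin 2)) (θ : ℝ) :
    fderiv ℝ (fderiv ℝ w) x (radialVec θ) (tangentVec θ) ^ 2 ≤ ‖fderiv ℝ (gradient w) x‖ ^ 2 := by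
  have h : fderiv ℝ (fderiv ℝ w) x (radialVec θ) (tangentVec θ)
      = inner ℝ (fderiv ℝ (gradient w) x (radialVec θ)) (tangentVec θ) := by
    rw [(hasFDerivAt_gradient hw x).fderiv, ContinuousLinearMap.comp_apply, inner_dualToPlane]
  rw [h, ← sq_abs]
  apply pow_le_pow_left₀ (abs_nonneg _)
  calc _ ≤ ‖fderiv ℝ (gradient w) x (radialVec θ)‖ * ‖tangentVec θ‖ := abs_real_inner_le_norm _ _
    _ ≤ ‖fderiv ℝ (gradient w) x‖ := by
      simpa using (fderiv ℝ (gradient w) x).le_opNorm (radialVec θ)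

lemma continuous_gradient (hw : ContDiff ℝ 2 w) : Continuous (gradient w) :=
  continuous_iff_continuousAt.2 fun x => (hasFDerivAt_gradient hw x).continuousAt

lemma continuous_fderiv_gradient (hw : ContDiff ℝ 2 w) : Continuous (fderiv ℝ (gradient w)) := by
  rw [funext fun x => (hasFDerivAt_gradient hw x).fderiv]
  exact continuous_const.clm_comp ((contDiff_one_fderiv hw).continuous_fderiv (by norm_num))

end PolarDerivatives

lemma integral_annulus2_eq_polar {μ ρ : ℝ} (hμ : 0 < μ) (g : EuclideanSpace ℝ (Fin 2) → ℝ) :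
    ∫ x in annulus2 μ ρ, g x =
      ∫ p in Set.Icc μ ρ ×ˢ Set.Icc (-π) π, p.1 * g (p.1 • radialVec p.2) := by
  have hmeas : MeasurableSet (annulus2 μ ρ) :=
    (measurableSet_lt measurable_const measurable_norm).inter
      (measurableSet_lt measurable_norm measurable_const)
  have h1 := (PiLp.volume_preserving_toLp (Fin 2)).comp (volume_preserving_finTwoArrow ℝ).symm
  have hemb : MeasurableEmbedding (WithLp.toLp 2 ∘ (MeasurableEquiv.finTwoArrow (α := ℝ)).symm) :=
    (MeasurableEquiv.toLp 2 (Fin 2 → ℝ)).measurableEmbedding.comp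
      (MeasurableEquiv.finTwoArrow (α := ℝ)).symm.measurableEmbedding
  rw [← integral_indicator hmeas, ← h1.integral_comp hemb, ← integral_comp_polarCoord_symm]
  have h2 : ∀ p ∈ polarCoord.target, (WithLp.toLp 2 ∘ (MeasurableEquiv.finTwoArrow (α := ℝ)).symm)
      (polarCoord.symm p) = p.1 • radialVec p.2 := by
    intro p _
    ext i
    fin_cases i <;> simp [radialVec, polarCoord, MeasurableEquiv.finTwoArrow]
  have h3 : ∫ p in polarCoord.target, p.1 • (annulus2 μ ρ).indicator g
      ((WithLp.toLp 2 ∘ (MeasurableEquiv.finTwoArrow (α := ℝ)).symm) (polarCoord.symm p))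
      = ∫ p in polarCoord.target, (Set.Ioo μ ρ ×ˢ Set.Ioo (-π) π).indicator
        (fun p : ℝ × ℝ => p.1 * g (p.1 • radialVec p.2)) p := by
    apply setIntegral_congr_fun polarCoord.open_target.measurableSet
    intro p hp
    simp only
    rw [h2 p hp]
    have hp1 : 0 < p.1 := hp.1
    have hn : ‖p.1 • radialVec p.2‖ = p.1 := by
      rw [norm_smul, norm_radialVec, mul_one, Real.norm_of_nonneg hp1.le]
    by_cases h : p.1 ∈ Set.Ioo μ ρ
    · rw [Set.indicator_of_mem (show p.1 • radialVec p.2 ∈ annulus2 μ ρ by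
        rwa [annulus2, Set.mem_ofPred_eq, hn]), Set.indicator_of_mem (Set.mk_mem_prod h hp.2),
        smul_eq_mul]
    · rw [Set.indicator_of_notMem (show p.1 • radialVec p.2 ∉ annulus2 μ ρ by
        rwa [annulus2, Set.mem_ofPred_eq, hn]),
        Set.indicator_of_notMem (fun h' => h h'.1), smul_zero]
  rw [h3, setIntegral_indicator (measurableSet_Ioo.prod measurableSet_Ioo)]
  have h4 : polarCoord.target ∩ Set.Ioo μ ρ ×ˢ Set.Ioo (-π) π = Set.Ioo μ ρ ×ˢ Set.Ioo (-π) π := by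
    apply Set.inter_eq_right.2
    rintro p ⟨hp1, hp2⟩
    exact ⟨hμ.trans hp1.1, hp2⟩
  rw [h4]
  apply setIntegral_congr_set
  exact Measure.set_prod_ae_eq Ioo_ae_eq_Icc Ioo_ae_eq_Icc

lemma dist_smul_radialVec_sq (ρ θ θ' : ℝ) :
    dist (ρ • radialVec θ) (ρ • radialVec θ') ^ 2 = (2 * ρ * sin ((θ - θ') / 2)) ^ 2 := by
  rw [EuclideanSpace.dist_eq, sq_sqrt (by positivity)]
  have h1 : cos (θ - θ') = 1 - 2 * sin ((θ - θ') / 2) ^ 2 := by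
    have h2 := cos_two_mul ((θ - θ') / 2)
    rw [mul_div_cancel₀ _ two_ne_zero] at h2
    linear_combination h2 + 2 * sin_sq_add_cos_sq ((θ - θ') / 2)
  rw [cos_sub] at h1
  simp [Fin.sum_univ_two, radialVec, Real.dist_eq, sq_abs]
  linear_combination (-2 * ρ ^ 2) * h1 + ρ ^ 2 * sin_sq_add_cos_sq θ + ρ ^ 2 * sin_sq_add_cos_sq θ'

lemma abs_sub_le_dist_smul_radialVec {ρ θ θ' : ℝ} (hρ : 0 < ρ) (h : |θ - θ'| ≤ π) :
    |θ - θ'| ≤ π / (2 * ρ) * dist (ρ • radialVec θ) (ρ • radialVec θ') := by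
  have h1 : 2 / π * (|θ - θ'| / 2) ≤ sin (|θ - θ'| / 2) :=
    mul_le_sin (by positivity) (by linarith)
  have h2 : dist (ρ • radialVec θ) (ρ • radialVec θ') = 2 * ρ * sin (|θ - θ'| / 2) := by
    have h3 : 0 ≤ sin (|θ - θ'| / 2) := le_trans (by positivity) h1
    rw [← sq_eq_sq₀ dist_nonneg (by positivity), dist_smul_radialVec_sq]
    rcases abs_cases (θ - θ') with h | h <;> rw [h.1]
    rw [neg_div, sin_neg]
    ring
  rw [h2]
  have hπ := pi_pos
  calc |θ - θ'| = π * (2 / π * (|θ - θ'| / 2)) := by field_simp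
    _ ≤ π * sin (|θ - θ'| / 2) := by gcongr
    _ = _ := by field_simp

lemma dist_smul_radialVec_le {ρ : ℝ} (hρ : 0 < ρ) (θ θ' : ℝ) :
    dist (ρ • radialVec θ) (ρ • radialVec θ') ≤ ρ * |θ - θ'| := by
  rw [← pow_le_pow_iff_left₀ dist_nonneg (by positivity) two_ne_zero, dist_smul_radialVec_sq,
    sq_le_sq, abs_mul, abs_of_pos (by positivity : 0 < 2 * ρ), abs_of_nonneg (a := ρ * |θ - θ'|)
    (by positivity)]
  have := abs_sin_le_abs (x := (θ - θ') / 2)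
  rw [abs_div, abs_two] at this
  nlinarith

lemma hausdorffMeasure_sphere_lt_top {ρ : ℝ} (hρ : 0 < ρ) :
    μH[1] (Metric.sphere (0 : EuclideanSpace ℝ (Fin 2)) ρ) < ⊤ := by
  have hlip : LipschitzWith ⟨ρ, hρ.le⟩ (fun θ : ℝ => ρ • radialVec θ) :=
    LipschitzWith.of_dist_le_mul fun θ θ' => dist_smul_radialVec_le hρ θ θ'
  have hsub : Metric.sphere (0 : EuclideanSpace ℝ (Fin 2)) ρ ⊆
      (fun θ : ℝ => ρ • radialVec θ) '' Set.Icc (-π) π := by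
    intro x hx
    have hn : ‖x‖ = ρ := by simpa using hx
    have hz : ‖(⟨x 0, x 1⟩ : ℂ)‖ = ρ := by
      rw [← hn, EuclideanSpace.norm_eq, Complex.norm_eq_sqrt_sq_add_sq]
      simp [Fin.sum_univ_two]
    refine ⟨Complex.arg ⟨x 0, x 1⟩, ⟨(Complex.neg_pi_lt_arg _).le, Complex.arg_le_pi _⟩, ?_⟩
    have h0 := Complex.norm_mul_cos_arg ⟨x 0, x 1⟩
    have h1 := Complex.norm_mul_sin_arg ⟨x 0, x 1⟩
    rw [hz] at h0 h1
    ext i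
    fin_cases i
    · simpa [radialVec] using h0
    · simpa [radialVec] using h1
  calc _ ≤ _ := measure_mono hsub
    _ ≤ _ := hlip.hausdorffMeasure_image_le zero_le_one _
    _ < ⊤ := by
      rw [hausdorffMeasure_real]
      exact ENNReal.mul_lt_top (by rw [ENNReal.rpow_one]; exact ENNReal.coe_lt_top) (by simp)

lemma map_smul_radialVec_le {ρ : ℝ} (hρ : 0 < ρ) (a : ℝ) :
    (volume.restrict (Set.Icc a (a + π))).map (fun θ : ℝ => ρ • radialVec θ) ≤
      ENNReal.ofReal (π / (2 * ρ)) •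
        (μH[1]).restrict (Metric.sphere (0 : EuclideanSpace ℝ (Fin 2)) ρ) := by
  have hcont : Continuous fun θ : ℝ => ρ • radialVec θ := continuous_radialVec.const_smul ρ
  have hK : 0 ≤ π / (2 * ρ) := by positivity
  refine Measure.le_iff.2 fun B hB => ?_
  rw [Measure.map_apply hcont.measurable hB,
    Measure.restrict_apply (hcont.measurable hB), Measure.smul_apply, Measure.restrict_apply hB,
    smul_eq_mul]
  have hanti : AntilipschitzWith ⟨π / (2 * ρ), hK⟩
      (fun θ : Set.Icc a (a + π) => ρ • radialVec θ) := by
    refine AntilipschitzWith.of_le_mul_dist fun θ θ' => ?_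
    refine abs_sub_le_dist_smul_radialVec hρ ?_
    exact abs_sub_le_iff.2 ⟨by linarith [θ.2.2, θ'.2.1], by linarith [θ'.2.2, θ.2.1]⟩
  have h1 := hanti.hausdorffMeasure_preimage_le (d := 1) zero_le_one (B ∩ Metric.sphere 0 ρ)
  have h2 : (fun θ : ℝ => ρ • radialVec θ) ⁻¹' B ∩ Set.Icc a (a + π) = Subtype.val ''
      ((fun θ : Set.Icc a (a + π) => ρ • radialVec θ) ⁻¹' (B ∩ Metric.sphere 0 ρ)) := by
    ext θ
    simp [norm_smul, abs_of_pos hρ, and_comm]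
  rw [h2, ← hausdorffMeasure_real, (isometry_subtype_coe).hausdorffMeasure_image (Or.inl zero_le_one)]
  refine h1.trans_eq ?_
  rw [ENNReal.rpow_one]
  congr 1
  exact (ENNReal.ofReal_eq_coe_nnreal hK).symm

lemma integral_circle_le_hausdorff {ρ : ℝ} (hρ : 0 < ρ) {g : EuclideanSpace ℝ (Fin 2) → ℝ}
    (hg : ContinuousOn g (Metric.sphere 0 ρ)) (hg0 : ∀ x, 0 ≤ g x) :
    ρ * ∫ θ in Set.Icc (-π) π, g (ρ • radialVec θ) ≤
      4 * ∫ x in Metric.sphere (0 : EuclideanSpace ℝ (Fin 2)) ρ, g x ∂μH[1] := by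
  set S := Metric.sphere (0 : EuclideanSpace ℝ (Fin 2)) ρ
  have hcont : Continuous fun θ : ℝ => ρ • radialVec θ := continuous_radialVec.const_smul ρ
  have hmem : ∀ θ : ℝ, ρ • radialVec θ ∈ S := fun θ => by
    simp [S, norm_smul, abs_of_pos hρ]
  have hgc : Continuous fun θ : ℝ => g (ρ • radialVec θ) :=
    hg.comp_continuous hcont hmem
  have hgint : IntegrableOn g S μH[1] := by
    have : IsFiniteMeasureOnCompacts ((μH[1]).restrict S) := by
      have : IsFiniteMeasure ((μH[1]).restrict S) :=
        ⟨by rw [Measure.restrict_apply_univ]; exact hausdorffMeasure_sphere_lt_top hρ⟩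
      infer_instance
    have := hg.integrableOn_compact (μ := (μH[1]).restrict S) (isCompact_sphere 0 ρ)
    rwa [IntegrableOn, Measure.restrict_restrict Metric.isClosed_sphere.measurableSet,
      Set.inter_self] at this
  have half : ∀ a : ℝ, ρ * ∫ θ in Set.Icc a (a + π), g (ρ • radialVec θ) ≤
      2 * ∫ x in S, g x ∂μH[1] := by
    intro a
    have hgint' : Integrable g (ENNReal.ofReal (π / (2 * ρ)) • (μH[1]).restrict S) :=
      hgint.smul_measure ENNReal.ofReal_ne_top
    have h1 := integral_mono_measure (map_smul_radialVec_le hρ a)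
      (Filter.Eventually.of_forall hg0) hgint'
    rw [integral_map hcont.aemeasurable (hgint'.mono_measure
      (map_smul_radialVec_le hρ a)).aestronglyMeasurable, integral_smul_measure,
      ENNReal.toReal_ofReal (by positivity), smul_eq_mul] at h1
    have h0 : 0 ≤ ∫ x in S, g x ∂μH[1] := integral_nonneg hg0
    calc _ ≤ ρ * (π / (2 * ρ) * ∫ x in S, g x ∂μH[1]) := by gcongr
      _ = π / 2 * ∫ x in S, g x ∂μH[1] := by field_simp
      _ ≤ _ := by gcongr; linarith [pi_le_four]
  have h1 := half (-π)
  have h2 := half 0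
  rw [neg_add_cancel] at h1
  rw [zero_add] at h2
  have hπ := pi_pos
  have hsplit : ∫ θ in Set.Icc (-π) π, g (ρ • radialVec θ) =
      (∫ θ in Set.Icc (-π) 0, g (ρ • radialVec θ)) + ∫ θ in Set.Icc 0 π, g (ρ • radialVec θ) := by
    rw [integral_Icc_eq_integral_Ioc, integral_Icc_eq_integral_Ioc, integral_Icc_eq_integral_Ioc,
      ← intervalIntegral.integral_of_le (by linarith), ← intervalIntegral.integral_of_le (by linarith),
      ← intervalIntegral.integral_of_le (by linarith)]
    exact (intervalIntegral.integral_add_adjacent_intervals (hgc.intervalIntegrable _ _)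
      (hgc.intervalIntegrable _ _)).symm
  rw [hsplit, mul_add]
  linarith

lemma hasDerivAt_sqrt_mul_exp {r : ℝ} (hr : 0 < r) (lam : ℝ) :
    HasDerivAt (fun r => √r * exp (lam * r)) ((lam + 1 / (2 * r)) * (√r * exp (lam * r))) r := by
  have h1 := ((hasDerivAt_id r).const_mul lam).exp
  refine ((hasDerivAt_sqrt hr.ne').mul h1).congr_deriv ?_
  have h2 : √r ≠ 0 := (sqrt_pos.2 hr).ne'
  have h3 : √r ^ 2 = r := sq_sqrt hr.le
  simp only [id, mul_one]
  field_simp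
  rw [h3]
  ring

lemma sq_sqrt_mul_exp {r : ℝ} (hr : 0 ≤ r) (lam : ℝ) :
    (√r * exp (lam * r)) ^ 2 = r * exp (2 * lam * r) := by
  rw [mul_pow, sq_sqrt hr, ← exp_nat_mul]
  congr 2
  push_cast
  ring

set_option maxHeartbeats 1000000 in
/-- Carleman's estimate in polar coordinates: `W`, `P`, `Q` stand for a function, its radial and
its normalized tangential derivative, and `A`, `B`, `T` for the second derivatives. -/
lemma carleman_polar {μ ρ s ε γ : ℝ} (hμ : 0 < μ) (hμρ : μ < ρ)
    (hs : 32 ≤ s) (hε : 0 < ε) (hε1 : ε ≤ 1) (hγ : 0 < γ) (hγ8 : γ ≤ 1 / 8) (hγρ : γ * (2 * ρ) ≤ 1)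
    (hsε : 8 ≤ s * ε) (hsγ : 8 ≤ s * γ) (hsμ : 1 ≤ s * μ) (hsμρ : 1 ≤ s * (ρ - μ))
    (hγε : 3 * γ ≤ 5 * (ε * s ^ 2))
    {W P Q A B T : ℝ → ℝ → ℝ} {K : Set (ℝ × ℝ)}
    (hK : K = Set.Icc μ ρ ×ˢ Set.Icc (-π) π)
    (cW : Continuous fun p : ℝ × ℝ => W p.1 p.2) (cP : Continuous fun p : ℝ × ℝ => P p.1 p.2)
    (cQ : Continuous fun p : ℝ × ℝ => Q p.1 p.2) (cA : Continuous fun p : ℝ × ℝ => A p.1 p.2)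
    (cB : Continuous fun p : ℝ × ℝ => B p.1 p.2) (cT : Continuous fun p : ℝ × ℝ => T p.1 p.2)
    (dW : ∀ r θ, HasDerivAt (fun r => W r θ) (P r θ) r)
    (dP : ∀ r θ, HasDerivAt (fun r => P r θ) (A r θ) r)
    (dQ : ∀ r θ, HasDerivAt (fun r => Q r θ) (B r θ) r)
    (tW : ∀ r θ, HasDerivAt (fun θ => W r θ) (r * Q r θ) θ)
    (tP : ∀ r θ, HasDerivAt (fun θ => P r θ) (r * B r θ + Q r θ) θ)
    (tQ : ∀ r θ, HasDerivAt (fun θ => r * Q r θ) (r ^ 2 * T r θ - r * P r θ) θ)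
    (pW : ∀ r, W r (-π) = W r π) (pP : ∀ r, P r (-π) = P r π) (pQ : ∀ r, Q r (-π) = Q r π) :
    γ / 10 * (∫ p in K, p.1 * ((s ^ 2 * (P p.1 p.2 ^ 2 + Q p.1 p.2 ^ 2) + s ^ 6 * W p.1 p.2 ^ 2)
        * exp (2 * s ^ 2 * p.1))) ≤
      2 / γ * (∫ p in K, p.1 * ((A p.1 p.2 + T p.1 p.2) ^ 2 * exp (2 * s ^ 2 * p.1)))
      + 5 * ε * s ^ 2 * exp (2 * s ^ 2 * ρ)
        * (ρ * ∫ θ in Set.Icc (-π) π, (P ρ θ ^ 2 + s ^ 4 * W ρ θ ^ 2))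
      + s ^ 2 * exp (2 * s ^ 2 * μ) * (μ * ∫ θ in Set.Icc (-π) π, Q μ θ ^ 2) := by
  have hρ : 0 < ρ := hμ.trans hμρ
  have hKc : IsCompact K := hK ▸ isCompact_Icc.prod isCompact_Icc
  have hKm : MeasurableSet K := hK ▸ measurableSet_Icc.prod measurableSet_Icc
  have hK1 : ∀ p ∈ K, p.1 ∈ Set.Icc μ ρ := fun p hp => by rw [hK] at hp; exact hp.1
  have hK0 : ∀ p ∈ K, 0 < p.1 := fun p hp => hμ.trans_le (hK1 p hp).1
  have hKne : ∀ p ∈ K, 2 * p.1 ≠ 0 := fun p hp => by have := hK0 p hp; positivity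
  have hKne2 : ∀ p ∈ K, 2 * p.1 ^ 2 ≠ 0 := fun p hp => by have := hK0 p hp; positivity
  have hKne3 : ∀ p ∈ K, p.1 ^ 2 ≠ 0 := fun p hp => by have := hK0 p hp; positivity
  have hKne4 : ∀ p ∈ K, 4 * p.1 ^ 2 ≠ 0 := fun p hp => by have := hK0 p hp; positivity
  obtain ⟨G, hG⟩ : ∃ G : ℝ → ℝ, G = fun r => √r * exp (s ^ 2 * r) := ⟨_, rfl⟩
  obtain ⟨k, hk⟩ : ∃ k : ℝ → ℝ, k = fun r => s ^ 2 + 1 / (2 * r) := ⟨_, rfl⟩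
  obtain ⟨k', hk'⟩ : ∃ k' : ℝ → ℝ, k' = fun r => -(1 / (2 * r ^ 2)) := ⟨_, rfl⟩
  have cG : Continuous G := by rw [hG]; fun_prop
  have ck : ContinuousOn (fun p : ℝ × ℝ => k p.1) K := by
    rw [hk]
    exact continuousOn_const.add (continuousOn_const.div (by fun_prop) hKne)
  have ck' : ContinuousOn (fun p : ℝ × ℝ => k' p.1) K := by
    rw [hk']
    exact (continuousOn_const.div (by fun_prop) hKne2).neg
  have dG : ∀ r, 0 < r → HasDerivAt G (k r * G r) r := fun r hr => by
    simp only [hG, hk]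
    exact hasDerivAt_sqrt_mul_exp hr _
  have dk : ∀ r, 0 < r → HasDerivAt k (k' r) r := fun r hr => by
    have h1 : HasDerivAt (fun r : ℝ => 2 * r) 2 r := by
      simpa using (hasDerivAt_id r).const_mul (2 : ℝ)
    have h2 := ((hasDerivAt_const r (1 : ℝ)).div h1 (by positivity)).const_add (s ^ 2)
    simp only [hk, hk']
    refine h2.congr_deriv ?_
    field_simp
    ring
  have hG2 : ∀ r, 0 < r → G r ^ 2 = r * exp (2 * s ^ 2 * r) := fun r hr => by
    simp only [hG]
    exact sq_sqrt_mul_exp hr.le _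
  have hk2 : ∀ r, μ ≤ r → 0 ≤ k r ∧ k r ^ 2 ≤ 2 * s ^ 4 := fun r hr => by
    have hr0 : 0 < r := hμ.trans_le hr
    have h1 : 1 / (2 * r) ≤ s ^ 2 * (1 / 64) := by
      rw [div_le_iff₀ (by positivity)]
      nlinarith [mul_le_mul_of_nonneg_left hr (by linarith : 0 ≤ s)]
    have h2 : 0 ≤ 1 / (2 * r) := by positivity
    have h3 : k r ≤ s ^ 2 * (65 / 64) := by simp only [hk]; linarith
    have h4 : 0 ≤ k r := by simp only [hk]; positivity
    refine ⟨h4, (pow_le_pow_left₀ h4 h3 2).trans ?_⟩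
    nlinarith [sq_nonneg (s ^ 2)]
  have cG1 : ContinuousOn (fun p : ℝ × ℝ => G p.1) K := (cG.comp continuous_fst).continuousOn
  have c1 : ContinuousOn (fun p : ℝ × ℝ => p.1) K := continuousOn_fst
  have cvr : ContinuousOn (fun p : ℝ × ℝ => G p.1 * (P p.1 p.2 + k p.1 * W p.1 p.2)) K :=
    cG1.mul (cP.continuousOn.add (ck.mul cW.continuousOn))
  have main := carleman_on_rectangle hμ hμρ hs hε hε1 hγ hγ8 hγρ hsε hsγ hsμ hsμρ
    (v := fun r θ => G r * W r θ) (vr := fun r θ => G r * (P r θ + k r * W r θ))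
    (vt := fun r θ => G r * (r * Q r θ))
    (vrr := fun r θ => k r * G r * (P r θ + k r * W r θ)
      + G r * (A r θ + (k' r * W r θ + k r * P r θ)))
    (vrt := fun r θ => G r * (r * B r θ + Q r θ + k r * (r * Q r θ)))
    (vtt := fun r θ => G r * (r ^ 2 * T r θ - r * P r θ)) hK
    (cG1.mul cW.continuousOn) cvr (cG1.mul (c1.mul cQ.continuousOn))
    (((ck.mul cG1).mul (cP.continuousOn.add (ck.mul cW.continuousOn))).add
      (cG1.mul (cA.continuousOn.add ((ck'.mul cW.continuousOn).add (ck.mul cP.continuousOn)))))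
    (cG1.mul (((c1.mul cB.continuousOn).add cQ.continuousOn).add
      (ck.mul (c1.mul cQ.continuousOn))))
    (cG1.mul (((c1.pow 2).mul cT.continuousOn).sub (c1.mul cP.continuousOn)))
    (fun r hr θ => by
      have hr0 : 0 < r := hμ.trans_le hr.1
      exact ((dG r hr0).mul (dW r θ)).congr_deriv (by ring))
    (fun r hr θ => by
      have hr0 : 0 < r := hμ.trans_le hr.1
      exact (dG r hr0).mul ((dP r θ).add ((dk r hr0).mul (dW r θ))))
    (fun r hr θ => by
      have hr0 : 0 < r := hμ.trans_le hr.1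
      exact ((dG r hr0).mul ((hasDerivAt_id r).mul (dQ r θ))).congr_deriv (by simp; ring))
    (fun r _ θ => (tW r θ).const_mul (G r))
    (fun r _ θ => ((tP r θ).add ((tW r θ).const_mul (k r))).const_mul (G r))
    (fun r _ θ => (tQ r θ).const_mul (G r))
    (fun r => by simp only [pW]) (fun r => by simp only [pW, pP]) (fun r => by simp only [pQ])
  have hF : ∫ p in K, (k p.1 * G p.1 * (P p.1 p.2 + k p.1 * W p.1 p.2)
      + G p.1 * (A p.1 p.2 + (k' p.1 * W p.1 p.2 + k p.1 * P p.1 p.2))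
      - 2 * s ^ 2 * (G p.1 * (P p.1 p.2 + k p.1 * W p.1 p.2)) + s ^ 4 * (G p.1 * W p.1 p.2)
      + G p.1 * (p.1 ^ 2 * T p.1 p.2 - p.1 * P p.1 p.2) / p.1 ^ 2
      + G p.1 * W p.1 p.2 / (4 * p.1 ^ 2)) ^ 2
      = ∫ p in K, p.1 * ((A p.1 p.2 + T p.1 p.2) ^ 2 * exp (2 * s ^ 2 * p.1)) := by
    refine setIntegral_congr_fun hKm fun p hp => ?_
    have hp0 := hK0 p hp
    have h1 := hG2 p.1 hp0
    rw [show p.1 * ((A p.1 p.2 + T p.1 p.2) ^ 2 * exp (2 * s ^ 2 * p.1))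
      = (G p.1 * (A p.1 p.2 + T p.1 p.2)) ^ 2 by rw [mul_pow, h1]; ring]
    congr 1
    simp only [hk, hk']
    field_simp
    ring
  have hL : γ / 10 * (∫ p in K, p.1 * ((s ^ 2 * (P p.1 p.2 ^ 2 + Q p.1 p.2 ^ 2)
      + s ^ 6 * W p.1 p.2 ^ 2) * exp (2 * s ^ 2 * p.1))) ≤
      ∫ p in K, (γ / 2 * s ^ 6 * (G p.1 * W p.1 p.2) ^ 2
        + ε / 2 * s ^ 4 * (G p.1 * (P p.1 p.2 + k p.1 * W p.1 p.2)) ^ 2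
        + γ * s ^ 2 * ((G p.1 * (p.1 * Q p.1 p.2)) ^ 2 / p.1 ^ 2)) := by
    rw [← integral_const_mul]
    refine setIntegral_mono_on ?_ ?_ hKm fun p hp => ?_
    · exact ContinuousOn.integrableOn_compact hKc (Continuous.continuousOn (by fun_prop))
    · refine ContinuousOn.integrableOn_compact hKc ?_
      exact ((continuousOn_const.mul ((cG1.mul cW.continuousOn).pow 2)).add
        (continuousOn_const.mul (cvr.pow 2))).add (continuousOn_const.mul
          (((cG1.mul (c1.mul cQ.continuousOn)).pow 2).div (c1.pow 2) hKne3))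
    have hp0 := hK0 p hp
    have h1 := hG2 p.1 hp0
    have h2 := (hk2 p.1 (hK1 p hp).1).2
    have h3 : (G p.1 * (p.1 * Q p.1 p.2)) ^ 2 / p.1 ^ 2 = G p.1 ^ 2 * Q p.1 p.2 ^ 2 := by
      field_simp
    rw [h3, mul_pow, mul_pow, ← sub_nonneg]
    have h4 : P p.1 p.2 ^ 2 ≤ 3 * (P p.1 p.2 + k p.1 * W p.1 p.2) ^ 2
        + 3 * s ^ 4 * W p.1 p.2 ^ 2 := by
      nlinarith [sq_nonneg (2 * P p.1 p.2 + 3 * k p.1 * W p.1 p.2),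
        mul_le_mul_of_nonneg_right h2 (sq_nonneg (W p.1 p.2))]
    have h5 : 0 ≤ γ / 2 * s ^ 6 * W p.1 p.2 ^ 2
        + ε / 2 * s ^ 4 * (P p.1 p.2 + k p.1 * W p.1 p.2) ^ 2 + γ * s ^ 2 * Q p.1 p.2 ^ 2
        - γ / 10 * (s ^ 2 * (P p.1 p.2 ^ 2 + Q p.1 p.2 ^ 2) + s ^ 6 * W p.1 p.2 ^ 2) := by
      have e1 := mul_le_mul_of_nonneg_left h4 (by positivity : 0 ≤ γ / 10 * s ^ 2)
      have e2 := mul_le_mul_of_nonneg_right hγε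
        (by positivity : 0 ≤ s ^ 2 / 10 * (P p.1 p.2 + k p.1 * W p.1 p.2) ^ 2)
      have e3 : 0 ≤ γ * s ^ 6 * W p.1 p.2 ^ 2 := by positivity
      have e4 : 0 ≤ γ * s ^ 2 * Q p.1 p.2 ^ 2 := by positivity
      linarith
    have h6 := mul_nonneg (sq_nonneg (G p.1)) h5
    rw [h1] at h6 ⊢
    linarith
  have hO : s ^ 2 * ε * (∫ θ in Set.Icc (-π) π, ((G ρ * (P ρ θ + k ρ * W ρ θ)) ^ 2
      + s ^ 4 * (G ρ * W ρ θ) ^ 2)) ≤ 5 * ε * s ^ 2 * exp (2 * s ^ 2 * ρ)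
        * (ρ * ∫ θ in Set.Icc (-π) π, (P ρ θ ^ 2 + s ^ 4 * W ρ θ ^ 2)) := by
    have cPρ : Continuous fun θ => P ρ θ := cP.comp (Continuous.prodMk_right ρ)
    have cWρ : Continuous fun θ => W ρ θ := cW.comp (Continuous.prodMk_right ρ)
    rw [← integral_const_mul, ← integral_const_mul, ← integral_const_mul]
    refine setIntegral_mono_on (Continuous.integrableOn_Icc (by fun_prop))
      (Continuous.integrableOn_Icc (by fun_prop)) measurableSet_Icc fun θ _ => ?_
    have h1 := hG2 ρ hρ
    have h2 := (hk2 ρ hμρ.le).2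
    have h4 : (P ρ θ + k ρ * W ρ θ) ^ 2 ≤ 5 * P ρ θ ^ 2 + 4 * s ^ 4 * W ρ θ ^ 2 := by
      nlinarith [sq_nonneg (P ρ θ - k ρ * W ρ θ), sq_nonneg (P ρ θ),
        mul_le_mul_of_nonneg_right h2 (sq_nonneg (W ρ θ))]
    have h5 := mul_le_mul_of_nonneg_left h4
      (by positivity : 0 ≤ s ^ 2 * ε * (ρ * exp (2 * s ^ 2 * ρ)))
    rw [mul_pow, mul_pow, h1]
    linarith
  have hI : s ^ 2 / μ ^ 2 * (∫ θ in Set.Icc (-π) π, (G μ * (μ * Q μ θ)) ^ 2)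
      = s ^ 2 * exp (2 * s ^ 2 * μ) * (μ * ∫ θ in Set.Icc (-π) π, Q μ θ ^ 2) := by
    have h1 : ∀ θ, (G μ * (μ * Q μ θ)) ^ 2 = μ * exp (2 * s ^ 2 * μ) * μ ^ 2 * Q μ θ ^ 2 :=
      fun θ => by rw [mul_pow, hG2 μ hμ]; ring
    rw [integral_congr_ae (Filter.Eventually.of_forall h1), integral_const_mul]
    field_simp
  beta_reduce at main
  rw [hF, hI] at main
  linarith

lemma polar_weighted_trace {μ ρ l lam : ℝ} (hμ : 0 < μ) (hl : 0 < l) (hlρ : μ + l ≤ ρ)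
    (hlam : 0 < lam) {Q B : ℝ → ℝ → ℝ} (cQ : Continuous fun p : ℝ × ℝ => Q p.1 p.2)
    (cB : Continuous fun p : ℝ × ℝ => B p.1 p.2)
    (dQ : ∀ r θ, HasDerivAt (fun r => Q r θ) (B r θ) r) :
    lam * exp (2 * lam * μ) * (μ * ∫ θ in Set.Icc (-π) π, Q μ θ ^ 2) ≤
      2 / l ^ 2 * (∫ p in Set.Icc μ ρ ×ˢ Set.Icc (-π) π,
        p.1 * (Q p.1 p.2 ^ 2 * exp (2 * lam * p.1)))
      + 2 * l * lam * exp (2 * lam * μ) *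
        ∫ p in Set.Icc μ ρ ×ˢ Set.Icc (-π) π, p.1 * B p.1 p.2 ^ 2 := by
  have hKc : IsCompact (Set.Icc μ ρ ×ˢ Set.Icc (-π) π) := isCompact_Icc.prod isCompact_Icc
  have cont : ∀ {f : ℝ × ℝ → ℝ}, Continuous f →
      IntegrableOn f (Set.Icc μ ρ ×ˢ Set.Icc (-π) π) := fun hf =>
    hf.continuousOn.integrableOn_compact hKc
  have i1 : IntegrableOn (fun p : ℝ × ℝ => 2 / l ^ 2 * (p.1 * (Q p.1 p.2 ^ 2 *
    exp (2 * lam * p.1)))) (Set.Icc μ ρ ×ˢ Set.Icc (-π) π) := cont (by fun_prop)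
  have i2 : IntegrableOn (fun p : ℝ × ℝ => 2 * l * lam * exp (2 * lam * μ) *
    (p.1 * B p.1 p.2 ^ 2)) (Set.Icc μ ρ ×ˢ Set.Icc (-π) π) := cont (by fun_prop)
  rw [← integral_const_mul, ← integral_const_mul, ← integral_const_mul, ← integral_const_mul,
    ← integral_add i1 i2, Measure.volume_eq_prod, ← Measure.prod_restrict, integral_prod_symm]
  swap
  · have := i1.add i2
    rwa [IntegrableOn, Measure.volume_eq_prod, ← Measure.prod_restrict] at this
  have i3 := i1.add i2
  rw [IntegrableOn, Measure.volume_eq_prod, ← Measure.prod_restrict] at i3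
  have cQμ : Continuous fun θ => Q μ θ := cQ.comp (Continuous.prodMk_right μ)
  refine integral_mono (Continuous.integrableOn_Icc (by fun_prop)) i3.integral_prod_right
    fun θ => ?_
  have cQθ : Continuous fun r => Q r θ := cQ.comp (Continuous.prodMk_left θ)
  have cBθ : Continuous fun r => B r θ := cB.comp (Continuous.prodMk_left θ)
  have h1 := weighted_trace hl hlρ hlam (fun r _ => dQ r θ) cBθ.continuousOn
  have h2 : (μ / l ^ 2) * (2 * (∫ r in Set.Icc μ ρ, Q r θ ^ 2 * exp (2 * lam * r))
      + 2 * l * (lam * l ^ 2) * exp (2 * lam * μ) * ∫ r in Set.Icc μ ρ, B r θ ^ 2) ≤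
      ∫ r in Set.Icc μ ρ, (2 / l ^ 2 * (r * (Q r θ ^ 2 * exp (2 * lam * r)))
        + 2 * l * lam * exp (2 * lam * μ) * (r * B r θ ^ 2)) := by
    rw [← integral_const_mul, ← integral_const_mul, ← integral_add
      (Continuous.integrableOn_Icc (by fun_prop)) (Continuous.integrableOn_Icc (by fun_prop)),
      ← integral_const_mul]
    refine setIntegral_mono_on (Continuous.integrableOn_Icc (by fun_prop))
      (Continuous.integrableOn_Icc (by fun_prop)) measurableSet_Icc fun r hr => ?_
    have h3 := mul_le_mul_of_nonneg_right hr.1 (by positivity : 0 ≤ 2 / l ^ 2 * (Q r θ ^ 2 *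
      exp (2 * lam * r)) + 2 * l * lam * exp (2 * lam * μ) * B r θ ^ 2)
    calc _ = μ * (2 / l ^ 2 * (Q r θ ^ 2 * exp (2 * lam * r))
          + 2 * l * lam * exp (2 * lam * μ) * B r θ ^ 2) := by field_simp
      _ ≤ _ := h3
      _ = _ := by ring
  refine le_trans ?_ h2
  calc lam * exp (2 * lam * μ) * (μ * Q μ θ ^ 2)
      = μ / l ^ 2 * (lam * l ^ 2 * Q μ θ ^ 2 * exp (2 * lam * μ)) := by field_simp
    _ ≤ _ := by gcongr

lemma continuousOn_radialDeriv2_sphere {w : EuclideanSpace ℝ (Fin 2) → ℝ} (hw : ContDiff ℝ 2 w)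
    {ρ : ℝ} (hρ : 0 < ρ) : ContinuousOn (radialDeriv2 w) (Metric.sphere 0 ρ) := by
  have h : ContinuousOn (fun x : EuclideanSpace ℝ (Fin 2) => ‖x‖⁻¹ • x) (Metric.sphere 0 ρ) := by
    refine (continuous_norm.continuousOn.inv₀ fun x hx => ?_).smul continuousOn_id
    rw [mem_sphere_zero_iff_norm.1 hx]
    exact hρ.ne'
  exact (contDiff_one_fderiv hw).continuous.continuousOn.clm_apply h

lemma radialDeriv2_smul_radialVec (w : EuclideanSpace ℝ (Fin 2) → ℝ) {r : ℝ} (hr : 0 < r) (θ : ℝ) :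
    radialDeriv2 w (r • radialVec θ) = fderiv ℝ w (r • radialVec θ) (radialVec θ) := by
  rw [radialDeriv2, norm_smul, norm_radialVec, mul_one, Real.norm_of_nonneg hr.le, smul_smul,
    inv_mul_cancel₀ hr.ne', one_smul]

/-- The Carleman estimate with explicit parameters, the weight exponent being `s ^ 2`. -/
lemma carleman_annulus {μ ρ s ε γ l : ℝ} (hμ : 0 < μ) (hμρ : μ < ρ)
    (hs : 32 ≤ s) (hε : 0 < ε) (hε1 : ε ≤ 1) (hγ : 0 < γ) (hγ8 : γ ≤ 1 / 8) (hγρ : γ * (2 * ρ) ≤ 1)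
    (hsε : 8 ≤ s * ε) (hsγ : 8 ≤ s * γ) (hsμ : 1 ≤ s * μ) (hsμρ : 1 ≤ s * (ρ - μ))
    (hγε : 3 * γ ≤ 5 * (ε * s ^ 2)) (hl : 0 < l) (hlρ : μ + l ≤ ρ)
    {w : EuclideanSpace ℝ (Fin 2) → ℝ} (hw : ContDiff ℝ 2 w) :
    γ / 10 * (s ^ 2 * (∫ x in annulus2 μ ρ, ‖gradient w x‖ ^ 2 * exp (2 * s ^ 2 * ‖x‖))
        + s ^ 6 * ∫ x in annulus2 μ ρ, w x ^ 2 * exp (2 * s ^ 2 * ‖x‖)) ≤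
      2 / γ * (∫ x in annulus2 μ ρ, lap2 w x ^ 2 * exp (2 * s ^ 2 * ‖x‖))
      + 20 * ε * s ^ 2 * exp (2 * s ^ 2 * ρ)
        * ((∫ x in Metric.sphere (0 : EuclideanSpace ℝ (Fin 2)) ρ, radialDeriv2 w x ^ 2 ∂μH[1])
          + s ^ 4 * ∫ x in Metric.sphere (0 : EuclideanSpace ℝ (Fin 2)) ρ, w x ^ 2 ∂μH[1])
      + 2 / l ^ 2 * (∫ x in annulus2 μ ρ, ‖gradient w x‖ ^ 2 * exp (2 * s ^ 2 * ‖x‖))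
      + 2 * l * s ^ 2 * exp (2 * s ^ 2 * μ) * H2normSq2 μ ρ w := by
  have hρ : 0 < ρ := hμ.trans hμρ
  have hs2 : 0 < s ^ 2 := by positivity
  obtain ⟨K, hK⟩ : ∃ K, K = Set.Icc μ ρ ×ˢ Set.Icc (-π) π := ⟨_, rfl⟩
  have hKc : IsCompact K := hK ▸ isCompact_Icc.prod isCompact_Icc
  have hKm : MeasurableSet K := hK ▸ measurableSet_Icc.prod measurableSet_Icc
  have hK0 : ∀ p ∈ K, 0 < p.1 := fun p hp => by rw [hK] at hp; exact hμ.trans_le hp.1.1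
  have cX : Continuous fun p : ℝ × ℝ => p.1 • radialVec p.2 :=
    continuous_fst.smul (continuous_radialVec.comp continuous_snd)
  have ce : Continuous fun p : ℝ × ℝ => radialVec p.2 := continuous_radialVec.comp continuous_snd
  have ct : Continuous fun p : ℝ × ℝ => tangentVec p.2 := continuous_tangentVec.comp continuous_snd
  have c1 : Continuous fun p : ℝ × ℝ => fderiv ℝ w (p.1 • radialVec p.2) :=
    (contDiff_one_fderiv hw).continuous.comp cX
  have c2 : Continuous fun p : ℝ × ℝ => fderiv ℝ (fderiv ℝ w) (p.1 • radialVec p.2) :=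
    ((contDiff_one_fderiv hw).continuous_fderiv (by norm_num)).comp cX
  obtain ⟨W, hW⟩ : ∃ W : ℝ → ℝ → ℝ, W = fun r θ => w (r • radialVec θ) := ⟨_, rfl⟩
  obtain ⟨P, hP⟩ : ∃ P : ℝ → ℝ → ℝ, P = fun r θ =>
    fderiv ℝ w (r • radialVec θ) (radialVec θ) := ⟨_, rfl⟩
  obtain ⟨Q, hQ⟩ : ∃ Q : ℝ → ℝ → ℝ, Q = fun r θ =>
    fderiv ℝ w (r • radialVec θ) (tangentVec θ) := ⟨_, rfl⟩
  obtain ⟨A, hA⟩ : ∃ A : ℝ → ℝ → ℝ, A = fun r θ =>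
    fderiv ℝ (fderiv ℝ w) (r • radialVec θ) (radialVec θ) (radialVec θ) := ⟨_, rfl⟩
  obtain ⟨B, hB⟩ : ∃ B : ℝ → ℝ → ℝ, B = fun r θ =>
    fderiv ℝ (fderiv ℝ w) (r • radialVec θ) (radialVec θ) (tangentVec θ) := ⟨_, rfl⟩
  obtain ⟨T, hT⟩ : ∃ T : ℝ → ℝ → ℝ, T = fun r θ =>
    fderiv ℝ (fderiv ℝ w) (r • radialVec θ) (tangentVec θ) (tangentVec θ) := ⟨_, rfl⟩
  have cW : Continuous fun p : ℝ × ℝ => W p.1 p.2 := by rw [hW]; exact hw.continuous.comp cX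
  have cP : Continuous fun p : ℝ × ℝ => P p.1 p.2 := by rw [hP]; exact c1.clm_apply ce
  have cQ : Continuous fun p : ℝ × ℝ => Q p.1 p.2 := by rw [hQ]; exact c1.clm_apply ct
  have cA : Continuous fun p : ℝ × ℝ => A p.1 p.2 := by
    rw [hA]; exact (c2.clm_apply ce).clm_apply ce
  have cB : Continuous fun p : ℝ × ℝ => B p.1 p.2 := by
    rw [hB]; exact (c2.clm_apply ce).clm_apply ct
  have cT : Continuous fun p : ℝ × ℝ => T p.1 p.2 := by
    rw [hT]; exact (c2.clm_apply ct).clm_apply ct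
  have dQ : ∀ r θ, HasDerivAt (fun r => Q r θ) (B r θ) r := by
    rw [hQ, hB]; exact fun r θ => polar_hasDerivAt_fderiv_fst hw r θ _
  have main := carleman_polar hμ hμρ hs hε hε1 hγ hγ8 hγρ hsε hsγ hsμ hsμρ hγε hK cW cP cQ cA cB cT
    (by rw [hW, hP]; exact polar_hasDerivAt_fst hw)
    (by rw [hP, hA]; exact fun r θ => polar_hasDerivAt_fderiv_fst hw r θ _)
    dQ
    (by rw [hW, hQ]; exact polar_hasDerivAt_snd hw)
    (by rw [hP, hB, hQ]; exact polar_hasDerivAt_fderiv_radial hw)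
    (by rw [hQ, hP, hT]; exact polar_hasDerivAt_fderiv_tangent hw)
    (fun r => by simp only [hW, radialVec_neg_pi])
    (fun r => by simp only [hP, radialVec_neg_pi])
    (fun r => by simp only [hQ, radialVec_neg_pi, tangentVec_neg_pi])
  have trace := polar_weighted_trace hμ hl hlρ hs2 cQ cB dQ
  rw [← hK] at trace
  have hn : ∀ p ∈ K, ‖p.1 • radialVec p.2‖ = p.1 := fun p hp => by
    rw [norm_smul, norm_radialVec, mul_one, Real.norm_of_nonneg (hK0 p hp).le]
  have cont : ∀ {f : ℝ × ℝ → ℝ}, Continuous f → IntegrableOn f K := fun hf =>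
    hf.continuousOn.integrableOn_compact hKc
  have hF : ∫ x in annulus2 μ ρ, lap2 w x ^ 2 * exp (2 * s ^ 2 * ‖x‖) =
      ∫ p in K, p.1 * ((A p.1 p.2 + T p.1 p.2) ^ 2 * exp (2 * s ^ 2 * p.1)) := by
    rw [integral_annulus2_eq_polar hμ, ← hK]
    refine setIntegral_congr_fun hKm fun p hp => ?_
    simp only [hn p hp, hA, hT, lap2_smul_radialVec hw _ p.2]
  have hD : ∫ x in annulus2 μ ρ, ‖gradient w x‖ ^ 2 * exp (2 * s ^ 2 * ‖x‖) =
      ∫ p in K, p.1 * ((P p.1 p.2 ^ 2 + Q p.1 p.2 ^ 2) * exp (2 * s ^ 2 * p.1)) := by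
    rw [integral_annulus2_eq_polar hμ, ← hK]
    refine setIntegral_congr_fun hKm fun p hp => ?_
    simp only [hn p hp, hP, hQ, norm_gradient_sq_eq _ p.2]
  have hV : ∫ x in annulus2 μ ρ, w x ^ 2 * exp (2 * s ^ 2 * ‖x‖) =
      ∫ p in K, p.1 * (W p.1 p.2 ^ 2 * exp (2 * s ^ 2 * p.1)) := by
    rw [integral_annulus2_eq_polar hμ, ← hK]
    refine setIntegral_congr_fun hKm fun p hp => ?_
    simp only [hn p hp, hW]
  have hH : ∫ p in K, p.1 * B p.1 p.2 ^ 2 ≤ H2normSq2 μ ρ w := by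
    rw [H2normSq2, integral_annulus2_eq_polar hμ, ← hK]
    have cg : Continuous fun p : ℝ × ℝ => gradient w (p.1 • radialVec p.2) :=
      (continuous_gradient hw).comp cX
    have cg2 : Continuous fun p : ℝ × ℝ => fderiv ℝ (gradient w) (p.1 • radialVec p.2) :=
      (continuous_fderiv_gradient hw).comp cX
    have cw : Continuous fun p : ℝ × ℝ => w (p.1 • radialVec p.2) := hw.continuous.comp cX
    refine setIntegral_mono_on (cont (by fun_prop)) (cont ?_) hKm fun p hp => ?_
    · exact continuous_fst.mul (((cw.pow 2).add (cg.norm.pow 2)).add (cg2.norm.pow 2))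
    refine mul_le_mul_of_nonneg_left ?_ (hK0 p hp).le
    simp only [hB]
    have := fderiv_fderiv_apply_sq_le hw (p.1 • radialVec p.2) p.2
    nlinarith [sq_nonneg (w (p.1 • radialVec p.2)), sq_nonneg ‖gradient w (p.1 • radialVec p.2)‖]
  have hL : ∫ p in K, p.1 * ((s ^ 2 * (P p.1 p.2 ^ 2 + Q p.1 p.2 ^ 2) + s ^ 6 * W p.1 p.2 ^ 2)
      * exp (2 * s ^ 2 * p.1)) =
      s ^ 2 * (∫ p in K, p.1 * ((P p.1 p.2 ^ 2 + Q p.1 p.2 ^ 2) * exp (2 * s ^ 2 * p.1)))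
      + s ^ 6 * ∫ p in K, p.1 * (W p.1 p.2 ^ 2 * exp (2 * s ^ 2 * p.1)) := by
    rw [← integral_const_mul, ← integral_const_mul,
      ← integral_add (cont (by fun_prop)) (cont (by fun_prop))]
    refine setIntegral_congr_fun hKm fun p _ => ?_
    ring
  have hQD : ∫ p in K, p.1 * (Q p.1 p.2 ^ 2 * exp (2 * s ^ 2 * p.1)) ≤
      ∫ p in K, p.1 * ((P p.1 p.2 ^ 2 + Q p.1 p.2 ^ 2) * exp (2 * s ^ 2 * p.1)) := by
    refine setIntegral_mono_on (cont (by fun_prop)) (cont (by fun_prop)) hKm fun p hp => ?_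
    have := (hK0 p hp).le
    gcongr
    linarith [sq_nonneg (P p.1 p.2)]
  have hS1 := integral_circle_le_hausdorff hρ
    (g := fun x => radialDeriv2 w x ^ 2) ((continuousOn_radialDeriv2_sphere hw hρ).pow 2)
    fun x => sq_nonneg _
  have hS2 := integral_circle_le_hausdorff hρ (g := fun x => w x ^ 2)
    (hw.continuous.pow 2).continuousOn fun x => sq_nonneg _
  simp only [radialDeriv2_smul_radialVec w hρ] at hS1
  have hO : ρ * (∫ θ in Set.Icc (-π) π, (P ρ θ ^ 2 + s ^ 4 * W ρ θ ^ 2)) ≤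
      4 * ((∫ x in Metric.sphere (0 : EuclideanSpace ℝ (Fin 2)) ρ, radialDeriv2 w x ^ 2 ∂μH[1])
        + s ^ 4 * ∫ x in Metric.sphere (0 : EuclideanSpace ℝ (Fin 2)) ρ, w x ^ 2 ∂μH[1]) := by
    have cPρ : Continuous fun θ => P ρ θ := cP.comp (Continuous.prodMk_right ρ)
    have cWρ : Continuous fun θ => W ρ θ := cW.comp (Continuous.prodMk_right ρ)
    rw [integral_add (Continuous.integrableOn_Icc (by fun_prop))
      (Continuous.integrableOn_Icc (by fun_prop)), integral_const_mul]
    simp only [hP, hW]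
    linarith [mul_le_mul_of_nonneg_left hS2 (by positivity : 0 ≤ s ^ 4)]
  rw [hL, ← hF, ← hD, ← hV] at main
  rw [← hD] at hQD
  have e1 := mul_le_mul_of_nonneg_left hO
    (by positivity : 0 ≤ 5 * ε * s ^ 2 * exp (2 * s ^ 2 * ρ))
  have e2 := mul_le_mul_of_nonneg_left hQD (by positivity : 0 ≤ 2 / l ^ 2)
  have e3 := mul_le_mul_of_nonneg_left hH
    (by positivity : 0 ≤ 2 * l * s ^ 2 * exp (2 * s ^ 2 * μ))
  linarith

/-- 2D Carleman estimate for the Laplacian with weight `e^{2λr}`,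
Theorem 3.2. Let `Ω_μ = {μ < |x| < ρ} ⊂ ℝ²`, `r = |x|`. There exist `λ₀ ≥ 1` and
`C > 0` depending only on `Ω_μ` such that for any `w ∈ C²(Ω̄_μ)` and all `λ ≥ λ₀` the
Carleman estimate holds, with boundary terms on the outer circle `S_ρ` (arc-length
measure `μH[1]`) and the penalty term `Cλe^{2λμ}‖w‖²_{H²(Ω_μ)}`. -/
theorem carleman_estimate_2D (μ ρ : ℝ) (hμ : 0 < μ) (hμρ : μ < ρ) :
    ∃ lam₀ : ℝ, 1 ≤ lam₀ ∧ ∃ C : ℝ, 0 < C ∧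
      ∀ w : EuclideanSpace ℝ (Fin 2) → ℝ, ContDiff ℝ 2 w →
      ∀ lam : ℝ, lam₀ ≤ lam →
        (∫ x in annulus2 μ ρ, (lap2 w x) ^ 2 * Real.exp (2 * lam * ‖x‖)) ≥
          (1/2) * (∫ x in annulus2 μ ρ, (lap2 w x) ^ 2 * Real.exp (2 * lam * ‖x‖))
          + C * lam * (∫ x in annulus2 μ ρ, ‖gradient w x‖ ^ 2 * Real.exp (2 * lam * ‖x‖))
          + C * lam ^ 3 * (∫ x in annulus2 μ ρ, (w x) ^ 2 * Real.exp (2 * lam * ‖x‖))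
          - C * lam * Real.exp (2 * lam * ρ)
              * (∫ x in Metric.sphere (0 : EuclideanSpace ℝ (Fin 2)) ρ,
                  (radialDeriv2 w x) ^ 2 ∂(μH[1]))
          - C * lam ^ 3 * Real.exp (2 * lam * ρ)
              * (∫ x in Metric.sphere (0 : EuclideanSpace ℝ (Fin 2)) ρ,
                  (w x) ^ 2 ∂(μH[1]))
          - C * lam * Real.exp (2 * lam * μ) * H2normSq2 μ ρ w := by
  have hρ : 0 < ρ := hμ.trans hμρ
  have hd : 0 < ρ - μ := sub_pos.2 hμρ
  obtain ⟨γ, hγ, hγ8, hγρ⟩ : ∃ γ : ℝ, 0 < γ ∧ γ ≤ 1 / 8 ∧ γ * (2 * ρ) ≤ 1 :=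
    ⟨min (1 / 8) (1 / (2 * ρ)), by positivity, min_le_left _ _,
      (le_div_iff₀ (by positivity)).1 (min_le_right _ _)⟩
  obtain ⟨ε, hε⟩ : ∃ ε : ℝ, ε = γ / 400 := ⟨_, rfl⟩
  have hε0 : 0 < ε := by rw [hε]; positivity
  obtain ⟨l, hl, hlγ, hlρ⟩ : ∃ l : ℝ, 0 < l ∧ l ≤ γ / 40 ∧ l ≤ ρ - μ :=
    ⟨min (γ / 40) (ρ - μ), by positivity, min_le_left _ _, min_le_right _ _⟩
  obtain ⟨s₀, hs₀⟩ : ∃ s₀ : ℝ, s₀ = 32 + 8 / ε + 1 / μ + 1 / (ρ - μ) := ⟨_, rfl⟩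
  have hp1 : 0 < 8 / ε := by positivity
  have hp2 : 0 < 1 / μ := by positivity
  have hp3 : 0 < 1 / (ρ - μ) := by positivity
  have hp4 : 0 < 40 / (γ * l ^ 2) := by positivity
  have hs₀1 : 32 ≤ s₀ := by linarith
  refine ⟨s₀ ^ 2 + 40 / (γ * l ^ 2), by nlinarith, γ ^ 2 / 80, by positivity, ?_⟩
  intro w hw lam hlam
  obtain ⟨s, hs, rfl⟩ : ∃ s, s₀ ≤ s ∧ lam = s ^ 2 := by
    refine ⟨√lam, le_sqrt_of_sq_le (by linarith), (sq_sqrt ?_).symm⟩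
    nlinarith
  have hs32 : 32 ≤ s := hs₀1.trans hs
  have hsε : 8 ≤ s * ε := (div_le_iff₀ hε0).1 (by linarith)
  have hsγ : 8 ≤ s * γ := by
    have : s * ε ≤ s * γ := mul_le_mul_of_nonneg_left (by rw [hε]; linarith) (by linarith)
    linarith
  have hsμ : 1 ≤ s * μ := (div_le_iff₀ hμ).1 (by linarith)
  have hsμρ : 1 ≤ s * (ρ - μ) := (div_le_iff₀ hd).1 (by linarith)
  have hsl : 40 ≤ s ^ 2 * (γ * l ^ 2) :=
    (div_le_iff₀ (by positivity)).1 (by linarith [sq_nonneg s₀])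
  have main := carleman_annulus hμ hμρ hs32 hε0 (by rw [hε]; linarith) hγ hγ8 hγρ hsε hsγ hsμ hsμρ
    (by rw [hε]; nlinarith) hl (by linarith) hw
  have hD : 0 ≤ ∫ x in annulus2 μ ρ, ‖gradient w x‖ ^ 2 * exp (2 * s ^ 2 * ‖x‖) :=
    integral_nonneg fun x => by positivity
  have hV : 0 ≤ ∫ x in annulus2 μ ρ, w x ^ 2 * exp (2 * s ^ 2 * ‖x‖) :=
    integral_nonneg fun x => by positivity
  have hH : 0 ≤ H2normSq2 μ ρ w := integral_nonneg fun x => by positivity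
  set F := ∫ x in annulus2 μ ρ, lap2 w x ^ 2 * exp (2 * s ^ 2 * ‖x‖)
  set D := ∫ x in annulus2 μ ρ, ‖gradient w x‖ ^ 2 * exp (2 * s ^ 2 * ‖x‖)
  set V := ∫ x in annulus2 μ ρ, w x ^ 2 * exp (2 * s ^ 2 * ‖x‖)
  set S₁ := ∫ x in Metric.sphere (0 : EuclideanSpace ℝ (Fin 2)) ρ, radialDeriv2 w x ^ 2 ∂μH[1]
  set S₂ := ∫ x in Metric.sphere (0 : EuclideanSpace ℝ (Fin 2)) ρ, w x ^ 2 ∂μH[1]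
  have e1 : 2 / l ^ 2 ≤ γ / 20 * s ^ 2 := by
    rw [div_le_iff₀ (by positivity)]
    linarith
  have e2 := mul_le_mul_of_nonneg_right e1 hD
  have e3 := mul_le_mul_of_nonneg_right hlγ
    (by positivity : 0 ≤ 2 * s ^ 2 * exp (2 * s ^ 2 * μ) * H2normSq2 μ ρ w)
  rw [hε] at main
  have e4 := mul_le_mul_of_nonneg_left (main.trans (by linarith :
    _ ≤ 2 / γ * F + γ / 20 * s ^ 2 * exp (2 * s ^ 2 * ρ) * (S₁ + s ^ 4 * S₂)
      + γ / 20 * s ^ 2 * D + γ / 20 * s ^ 2 * exp (2 * s ^ 2 * μ) * H2normSq2 μ ρ w))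
    (by positivity : 0 ≤ γ / 4)
  have e5 : γ / 4 * (2 / γ * F) = F / 2 := by field_simp; norm_num
  have e6 := mul_nonneg (by positivity : 0 ≤ γ ^ 2 / 80 * s ^ 6) hV
  linarith
end
end
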